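/- arXiv:1107.2315 — 3 statements merged into one kernel-verified Lean document; each statement's English description precedes it below -/
import Mathlib

section
/- Let v̂(x) = min(|x|^{−α}, 1). For every s > 0 one has 0 ≤ a₁ s^{d/α} − ∫_{ℝ^d} (1 − exp(−s v̂(y))) dy ≤ ω_d e^{−s}. In particular ∫_{ℝ^d} (1 − e^{−s v̂(y)}) dy = a₁ s^{d/α} + O(e^{−s}) as s → ∞. (This is the integral form of the moment generating function asymptotics E[exp(−sV_ω(0))] = exp{−a₁ s^{d/α} + O(e^{−s})} for the Poissonian potential.) -/
open MeasureTheory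

/-- The volume of the unit ball in `ℝ^d`. -/
noncomputable def omegaD (d : ℕ) : ℝ :=
  (volume (Metric.ball (0 : EuclideanSpace ℝ (Fin d)) 1)).toReal

/-- The shape function `v̂(x) = min(|x|^{−α}, 1)`. -/
noncomputable def vhat (d : ℕ) (α : ℝ) (x : EuclideanSpace ℝ (Fin d)) : ℝ :=
  min (‖x‖ ^ (-α)) 1

lemma omegaD_nonneg (d : ℕ) : 0 ≤ omegaD d := ENNReal.toReal_nonneg

/-- The superlevel sets of `‖y‖ ^ (-α)` are punctured balls. -/
lemma volume_lt_norm_rpow_neg {d : ℕ} (hd : 1 ≤ d) {α : ℝ} (hα : 0 < α) {t : ℝ} (ht : 0 < t) :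
    volume {y : EuclideanSpace ℝ (Fin d) | t < ‖y‖ ^ (-α)} =
      ENNReal.ofReal (omegaD d * t ^ (-((d : ℝ) / α))) := by
  have : Nonempty (Fin d) := ⟨⟨0, hd⟩⟩
  have hset : {y : EuclideanSpace ℝ (Fin d) | t < ‖y‖ ^ (-α)} =
      Metric.ball 0 (t ^ (-α)⁻¹) \ {0} := by
    ext y
    rcases eq_or_ne y 0 with rfl | hy
    · simp [Real.zero_rpow (neg_ne_zero.2 hα.ne'), ht.le]
    · simp [hy, -inv_neg,
        Real.lt_rpow_inv_iff_of_neg (norm_pos_iff.2 hy) ht (neg_lt_zero.2 hα)]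
  rw [hset, measure_sdiff_null (measure_singleton _),
    Measure.addHaar_ball_of_pos _ _ (Real.rpow_pos_of_pos ht _), finrank_euclideanSpace_fin,
    mul_comm (omegaD d), ENNReal.ofReal_mul (by positivity), omegaD,
    ENNReal.ofReal_toReal measure_ball_lt_top.ne, ← Real.rpow_mul_natCast ht.le]
  congr 3
  field_simp

lemma integral_mul_exp_neg_mul (s x : ℝ) :
    ∫ t in (0 : ℝ)..x, s * Real.exp (-(s * t)) = 1 - Real.exp (-s * x) := by
  have hderiv : ∀ t ∈ Set.uIcc 0 x,
      HasDerivAt (fun t ↦ -Real.exp (-(s * t))) (s * Real.exp (-(s * t))) t := fun t _ ↦ by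
    have h := (((hasDerivAt_id t).const_mul s).neg.exp).neg
    convert! h using 1
    simp
    ring
  rw [intervalIntegral.integral_eq_sub_of_hasDerivAt hderiv
    (Continuous.intervalIntegrable (by fun_prop) _ _)]
  simp
  ring

/-- The layer cake formula reduces the integral of `1 - exp (-s ‖y‖ ^ (-α))` to a Gamma
integral. -/
lemma lintegral_one_sub_exp_norm_rpow {d : ℕ} (hd : 1 ≤ d) {α : ℝ} (hα : (d : ℝ) < α)
    {s : ℝ} (hs : 0 < s) :
    ∫⁻ y : EuclideanSpace ℝ (Fin d), ENNReal.ofReal (1 - Real.exp (-s * ‖y‖ ^ (-α))) =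
      ENNReal.ofReal (omegaD d * Real.Gamma ((α - d) / α) * s ^ ((d : ℝ) / α)) := by
  have hα0 : 0 < α := (Nat.cast_nonneg d).trans_lt hα
  have ha : 0 < (α - d) / α := div_pos (sub_pos.2 hα) hα0
  have hΓ := Real.integral_rpow_mul_exp_neg_mul_Ioi ha hs
  have hgamma : IntegrableOn (fun t : ℝ ↦ t ^ ((α - d) / α - 1) * Real.exp (-(s * t)))
      (Set.Ioi 0) :=
    .of_integral_ne_zero (by rw [hΓ]; have := Real.Gamma_pos_of_pos ha; positivity)
  have hexp : (α - d) / α - 1 = -((d : ℝ) / α) := by field_simp; ring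
  have hlayer := lintegral_comp_eq_lintegral_meas_lt_mul
    (volume : Measure (EuclideanSpace ℝ (Fin d))) (f := fun y ↦ ‖y‖ ^ (-α))
    (g := fun t ↦ s * Real.exp (-(s * t)))
    (ae_of_all _ fun y ↦ Real.rpow_nonneg (norm_nonneg y) _) (by fun_prop)
    (fun t _ ↦ Continuous.intervalIntegrable (by fun_prop) _ _)
    (ae_of_all _ fun t ↦ by positivity)
  simp only [integral_mul_exp_neg_mul] at hlayer
  rw [hlayer]
  calc
    _ = ∫⁻ t in Set.Ioi (0 : ℝ), ENNReal.ofReal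
        (omegaD d * s * (t ^ ((α - d) / α - 1) * Real.exp (-(s * t)))) := by
      refine setLIntegral_congr_fun measurableSet_Ioi fun t ht ↦ ?_
      have ht : 0 < t := ht
      have := omegaD_nonneg d
      rw [volume_lt_norm_rpow_neg hd hα0 ht, ← ENNReal.ofReal_mul (by positivity), hexp]
      congr 1
      ring
    _ = ENNReal.ofReal (∫ t in Set.Ioi (0 : ℝ),
        omegaD d * s * (t ^ ((α - d) / α - 1) * Real.exp (-(s * t)))) := by
      refine (ofReal_integral_eq_lintegral_ofReal (hgamma.const_mul _) ?_).symm
      refine (ae_restrict_iff' measurableSet_Ioi).2 (ae_of_all _ fun t ht ↦ ?_)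
      have ht : 0 < t := ht
      have := omegaD_nonneg d
      simp only [Pi.zero_apply]
      positivity
    _ = _ := by
      rw [integral_const_mul, hΓ, one_div, Real.inv_rpow hs.le, ← Real.rpow_neg hs.le]
      have hs' : s ^ ((d : ℝ) / α) = s * s ^ (-((α - d) / α)) := by
        rw [← Real.rpow_one_add' hs.le]
        · congr 1; linarith
        · have : 1 + -((α - d) / α) = d / α := by linarith
          rw [this]
          have : (0 : ℝ) < d := by exact_mod_cast hd
          positivity
      rw [hs']
      congr 1
      ring

lemma one_sub_exp_neg_mul_nonneg {s x : ℝ} (hs : 0 ≤ s) (hx : 0 ≤ x) :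
    0 ≤ 1 - Real.exp (-s * x) := by
  rw [sub_nonneg, Real.exp_le_one_iff]
  nlinarith

lemma integrable_one_sub_exp_norm_rpow {d : ℕ} (hd : 1 ≤ d) {α : ℝ} (hα : (d : ℝ) < α)
    {s : ℝ} (hs : 0 < s) :
    Integrable fun y : EuclideanSpace ℝ (Fin d) ↦ 1 - Real.exp (-s * ‖y‖ ^ (-α)) := by
  refine ⟨Measurable.aestronglyMeasurable (by fun_prop), ?_⟩
  rw [hasFiniteIntegral_iff_ofReal (ae_of_all _ fun y ↦
    one_sub_exp_neg_mul_nonneg hs.le (Real.rpow_nonneg (norm_nonneg y) _)),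
    lintegral_one_sub_exp_norm_rpow hd hα hs]
  exact ENNReal.ofReal_lt_top

lemma integral_one_sub_exp_norm_rpow {d : ℕ} (hd : 1 ≤ d) {α : ℝ} (hα : (d : ℝ) < α)
    {s : ℝ} (hs : 0 < s) :
    ∫ y : EuclideanSpace ℝ (Fin d), (1 - Real.exp (-s * ‖y‖ ^ (-α))) =
      omegaD d * Real.Gamma ((α - d) / α) * s ^ ((d : ℝ) / α) := by
  have hα0 : 0 < α := (Nat.cast_nonneg d).trans_lt hα
  have hΓ := Real.Gamma_pos_of_pos (div_pos (sub_pos.2 hα) hα0)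
  have := omegaD_nonneg d
  rw [integral_eq_lintegral_of_nonneg_ae (ae_of_all _ fun y ↦
    one_sub_exp_neg_mul_nonneg hs.le (Real.rpow_nonneg (norm_nonneg y) _))
    (Measurable.aestronglyMeasurable (by fun_prop)),
    lintegral_one_sub_exp_norm_rpow hd hα hs, ENNReal.toReal_ofReal (by positivity)]

lemma vhat_nonneg (d : ℕ) (α : ℝ) (y : EuclideanSpace ℝ (Fin d)) : 0 ≤ vhat d α y :=
  le_min (Real.rpow_nonneg (norm_nonneg y) _) zero_le_one

lemma exp_norm_rpow_le_exp_vhat (d : ℕ) (α : ℝ) {s : ℝ} (hs : 0 ≤ s)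
    (y : EuclideanSpace ℝ (Fin d)) :
    Real.exp (-s * ‖y‖ ^ (-α)) ≤ Real.exp (-s * vhat d α y) :=
  Real.exp_le_exp.2 <| mul_le_mul_of_nonpos_left (min_le_left _ _) (neg_nonpos.2 hs)

/-- Truncating `‖y‖ ^ (-α)` at `1` only matters inside the unit ball. -/
lemma exp_vhat_sub_exp_norm_rpow_le (d : ℕ) {α : ℝ} (hα : 0 ≤ α) (s : ℝ)
    (y : EuclideanSpace ℝ (Fin d)) :
    Real.exp (-s * vhat d α y) - Real.exp (-s * ‖y‖ ^ (-α)) ≤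
      (Metric.ball (0 : EuclideanSpace ℝ (Fin d)) 1).indicator (fun _ ↦ Real.exp (-s)) y := by
  rcases le_total (‖y‖ ^ (-α)) 1 with h | h
  · rw [vhat, min_eq_left h, sub_self]
    exact Set.indicator_nonneg (fun _ _ ↦ (Real.exp_pos _).le) y
  · by_cases hy : ‖y‖ < 1
    · rw [vhat, min_eq_right h, Set.indicator_of_mem (mem_ball_zero_iff.2 hy), mul_one]
      exact sub_le_self _ (Real.exp_pos _).le
    · have h1 : ‖y‖ ^ (-α) ≤ 1 :=
        Real.rpow_le_one_of_one_le_of_nonpos (not_lt.1 hy) (neg_nonpos.2 hα)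
      rw [vhat, min_eq_left h1, sub_self]
      exact Set.indicator_nonneg (fun _ _ ↦ (Real.exp_pos _).le) y

/-- for every `s > 0`,
`0 ≤ a₁ s^{d/α} − ∫ (1 − exp(−s v̂(y))) dy ≤ ω_d e^{−s}`, where
`a₁ = ω_d Γ((α−d)/α)`. -/
theorem stmt_1 (d : ℕ) (hd : 1 ≤ d) (α : ℝ) (hα : (d : ℝ) < α)
    (s : ℝ) (hs : 0 < s) :
    0 ≤ omegaD d * Real.Gamma ((α - d) / α) * s ^ ((d : ℝ) / α)
        - (∫ y : EuclideanSpace ℝ (Fin d), (1 - Real.exp (-s * vhat d α y))) ∧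
    omegaD d * Real.Gamma ((α - d) / α) * s ^ ((d : ℝ) / α)
        - (∫ y : EuclideanSpace ℝ (Fin d), (1 - Real.exp (-s * vhat d α y)))
      ≤ omegaD d * Real.exp (-s) := by
  have hα0 : 0 ≤ α := (Nat.cast_nonneg d).trans hα.le
  have hw := integrable_one_sub_exp_norm_rpow hd hα hs
  have hv : Integrable fun y : EuclideanSpace ℝ (Fin d) ↦ 1 - Real.exp (-s * vhat d α y) := by
    refine hw.mono' (Measurable.aestronglyMeasurable (by unfold vhat; fun_prop))
      (ae_of_all _ fun y ↦ ?_)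
    rw [Real.norm_of_nonneg (one_sub_exp_neg_mul_nonneg hs.le (vhat_nonneg d α y))]
    exact sub_le_sub_left (exp_norm_rpow_le_exp_vhat d α hs.le y) 1
  rw [← integral_one_sub_exp_norm_rpow hd hα hs, ← integral_sub hw hv]
  simp only [sub_sub_sub_cancel_left]
  refine ⟨integral_nonneg fun y ↦ sub_nonneg.2 (exp_norm_rpow_le_exp_vhat d α hs.le y), ?_⟩
  calc
    _ ≤ ∫ y, (Metric.ball (0 : EuclideanSpace ℝ (Fin d)) 1).indicator
        (fun _ ↦ Real.exp (-s)) y := by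
      refine integral_mono
        ((hw.sub hv).congr (ae_of_all _ fun y ↦ sub_sub_sub_cancel_left _ _ _)) ?_
        (exp_vhat_sub_exp_norm_rpow_le d hα0 s)
      exact (integrable_indicator_iff measurableSet_ball).2
        (integrableOn_const measure_ball_lt_top.ne)
    _ = omegaD d * Real.exp (-s) := by
      rw [integral_indicator_const _ measurableSet_ball, smul_eq_mul]
      rfl
end

section
/- Fix ε ∈ (0, 1/α). There exists γ > 0 such that for every δ > 0 there is T > 0 with the following property: for all t ≥ T and every Borel probability measure μ on ℝ^d whose support is contained in the closed ball of radius t^{1/α−ε} centered at the origin, | ∫_{ℝ^d} ( 1 − exp( −t ∫ v̂(z−y) μ(dz) ) ) dy − a₁ t^{d/α} − C(d,α) t^{(d−2)/α} ∫ |z − m_μ|² μ(dz) | ≤ δ t^{(d−2)/α} ∫ |z − m_μ|² μ(dz) + exp(−t^γ). (This is the deterministic form of the Laplace-functional asymptotics E[exp(−t⟨μ, V_ω⟩)] = exp{ −a₁ t^{d/α} − (C(d,α)+o(1)) t^{(d−2)/α} ∫ |z−m_μ|² μ(dz) } for the Poissonian potential V_ω(x) = Σ_i v̂(x−ω_i).)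 -/
open MeasureTheory

/-- The constant `a₁ = ω_d Γ((α−d)/α)`. -/
noncomputable def a1 (d : ℕ) (α : ℝ) : ℝ :=
  omegaD d * Real.Gamma ((α - d) / α)

/-- The constant `C(d,α) = (α σ_d/(2d)) Γ((2α−d+2)/α)` with `σ_d = d ω_d`. -/
noncomputable def Cda (d : ℕ) (α : ℝ) : ℝ :=
  (α * ((d : ℝ) * omegaD d) / (2 * d)) * Real.Gamma ((2 * α - d + 2) / α)

lemma integrableOn_rpow_mul_exp_neg_rpow_neg {α a b : ℝ} (hα : 0 < α) (ha : 0 < a) (hb : 0 < b) :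
    IntegrableOn (fun r : ℝ => r ^ (-α * b - 1) * Real.exp (-a * r ^ (-α))) (Set.Ioi 0) := by
  have h1 : IntegrableOn (fun x : ℝ => x ^ (b - 1) * Real.exp (-a * x ^ (1 : ℝ))) (Set.Ioi 0) :=
    integrableOn_rpow_mul_exp_neg_mul_rpow (by linarith) one_pos ha
  have h2 := ((integrableOn_Ioi_comp_rpow_iff _ (neg_ne_zero.2 hα.ne')).2 h1).const_mul α⁻¹
  refine IntegrableOn.congr_fun h2 (fun r hr => ?_) measurableSet_Ioi
  have hr : 0 < r := hr
  simp only [abs_neg, abs_of_pos hα, smul_eq_mul, ← Real.rpow_mul hr.le]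
  rw [show -α * b - 1 = (-α - 1) + -α * (b - 1) by ring, Real.rpow_add hr]
  field_simp

lemma integral_rpow_mul_exp_neg_rpow_neg {α b : ℝ} (hα : 0 < α) (hb : 0 < b) :
    ∫ r in Set.Ioi (0 : ℝ), r ^ (-α * b - 1) * Real.exp (-r ^ (-α)) = Real.Gamma b / α := by
  have h1 := Real.integral_rpow_mul_exp_neg_mul_Ioi hb one_pos
  rw [← integral_comp_rpow_Ioi _ (neg_ne_zero.2 hα.ne')] at h1
  simp only [one_mul, div_one, Real.one_rpow] at h1
  rw [eq_div_iff hα.ne', ← h1, ← integral_mul_const]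
  refine setIntegral_congr_fun measurableSet_Ioi (fun r hr => ?_)
  have hr : 0 < r := hr
  simp only [abs_neg, abs_of_pos hα, smul_eq_mul, ← Real.rpow_mul hr.le]
  rw [show -α * b - 1 = (-α - 1) + -α * (b - 1) by ring, Real.rpow_add hr]
  ring

lemma nontrivial_euclideanSpace_fin {d : ℕ} (hd : 1 ≤ d) :
    Nontrivial (EuclideanSpace ℝ (Fin d)) :=
  Module.nontrivial_of_finrank_pos (R := ℝ) (by simp; omega)

lemma pow_mul_rpow_neg_eq {d : ℕ} (hd : 1 ≤ d) {α p r : ℝ} (hα : 0 < α) (hr : 0 < r) :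
    r ^ (d - 1) * r ^ (-p) = r ^ (-α * ((p - d) / α) - 1) := by
  rw [← Real.rpow_natCast, ← Real.rpow_add hr, Nat.cast_sub hd]
  congr 1
  field_simp
  push_cast
  ring

/-- Stretched-exponential damping at the origin makes every power decaying faster than
`|x|^{-d}` integrable on `ℝ^d`. -/
lemma integrable_norm_rpow_mul_exp {d : ℕ} (hd : 1 ≤ d) {α a p : ℝ} (hα : 0 < α) (ha : 0 < a)
    (hp : (d : ℝ) < p) :
    Integrable (fun x : EuclideanSpace ℝ (Fin d) =>
      ‖x‖ ^ (-p) * Real.exp (-a * ‖x‖ ^ (-α))) := by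
  have := nontrivial_euclideanSpace_fin hd
  rw [integrable_fun_norm_addHaar volume (f := fun r : ℝ => r ^ (-p) * Real.exp (-a * r ^ (-α)))]
  refine (integrableOn_rpow_mul_exp_neg_rpow_neg hα ha
    (div_pos (sub_pos.2 hp) hα)).congr_fun (fun r hr => ?_) measurableSet_Ioi
  simp only [smul_eq_mul, finrank_euclideanSpace, Fintype.card_fin]
  rw [← mul_assoc, pow_mul_rpow_neg_eq hd hα hr]

lemma integral_norm_rpow_mul_exp {d : ℕ} (hd : 1 ≤ d) {α p : ℝ} (hα : 0 < α) (hp : (d : ℝ) < p) :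
    ∫ x : EuclideanSpace ℝ (Fin d), ‖x‖ ^ (-p) * Real.exp (-‖x‖ ^ (-α)) =
      d * omegaD d * (Real.Gamma ((p - d) / α) / α) := by
  have := nontrivial_euclideanSpace_fin hd
  rw [integral_fun_norm_addHaar volume (fun r : ℝ => r ^ (-p) * Real.exp (-r ^ (-α))),
    ← integral_rpow_mul_exp_neg_rpow_neg hα (div_pos (sub_pos.2 hp) hα)]
  simp only [smul_eq_mul, finrank_euclideanSpace, Fintype.card_fin, nsmul_eq_mul, omegaD,
    Measure.real, mul_assoc]
  congr 2
  refine setIntegral_congr_fun measurableSet_Ioi (fun r hr => ?_)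
  rw [← mul_assoc, pow_mul_rpow_neg_eq hd hα hr]

lemma one_sub_exp_neg_nonneg {u : ℝ} (hu : 0 ≤ u) : 0 ≤ 1 - Real.exp (-u) := by
  have := Real.exp_le_one_iff.2 (neg_nonpos.2 hu)
  linarith

lemma one_sub_exp_neg_le (u : ℝ) : 1 - Real.exp (-u) ≤ u := by
  have := Real.add_one_le_exp (-u)
  linarith

lemma integrableOn_pow_mul_one_sub_exp {d : ℕ} (hd : 1 ≤ d) {α : ℝ} (hα : (d : ℝ) < α) :
    IntegrableOn (fun r : ℝ => r ^ (d - 1) * (1 - Real.exp (-r ^ (-α)))) (Set.Ioi 0) := by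
  have hmeas : Measurable (fun r : ℝ => r ^ (d - 1) * (1 - Real.exp (-r ^ (-α)))) := by fun_prop
  rw [← Set.Ioc_union_Ioi_eq_Ioi zero_le_one]
  refine IntegrableOn.union ?_ ?_
  · refine Integrable.mono' (integrableOn_const (C := (1 : ℝ)) (by simp))
      hmeas.aestronglyMeasurable ?_
    filter_upwards [ae_restrict_mem measurableSet_Ioc] with r hr
    have h0 : 0 ≤ r ^ (-α) := Real.rpow_nonneg hr.1.le _
    rw [Real.norm_of_nonneg (mul_nonneg (pow_nonneg hr.1.le _) (one_sub_exp_neg_nonneg h0))]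
    have := Real.exp_pos (-r ^ (-α))
    exact mul_le_one₀ (pow_le_one₀ hr.1.le hr.2) (one_sub_exp_neg_nonneg h0) (by linarith)
  · have hInt : IntegrableOn (fun r : ℝ => r ^ ((d : ℝ) - 1 - α)) (Set.Ioi 1) :=
      integrableOn_Ioi_rpow_of_lt (by linarith) one_pos
    refine Integrable.mono' hInt hmeas.aestronglyMeasurable ?_
    filter_upwards [ae_restrict_mem measurableSet_Ioi] with r hr
    have hr0 : 0 < r := lt_trans one_pos hr
    have h0 : 0 ≤ r ^ (-α) := Real.rpow_nonneg hr0.le _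
    rw [Real.norm_of_nonneg (mul_nonneg (pow_nonneg hr0.le _) (one_sub_exp_neg_nonneg h0)),
      sub_eq_add_neg _ α, Real.rpow_add hr0]
    rw [show (d : ℝ) - 1 = ((d - 1 : ℕ) : ℝ) by push_cast [Nat.cast_sub hd]; ring,
      Real.rpow_natCast]
    exact mul_le_mul_of_nonneg_left (one_sub_exp_neg_le _) (pow_nonneg hr0.le _)

lemma integral_pow_mul_one_sub_exp {d : ℕ} (hd : 1 ≤ d) {α : ℝ} (hα : (d : ℝ) < α) :
    d * ∫ r in Set.Ioi (0 : ℝ), r ^ (d - 1) * (1 - Real.exp (-r ^ (-α))) =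
      Real.Gamma ((α - d) / α) := by
  have hd0 : (0 : ℝ) < d := by exact_mod_cast hd
  have hα0 : 0 < α := hd0.trans hα
  have hb : 0 < (α - d) / α := div_pos (sub_pos.2 hα) hα0
  have hInt1 := (integrableOn_pow_mul_one_sub_exp hd hα).const_mul (d : ℝ)
  have hInt2 : IntegrableOn (fun r : ℝ => α * (r ^ (-α * ((α - d) / α) - 1) *
      Real.exp (-r ^ (-α)))) (Set.Ioi 0) := by
    have := (integrableOn_rpow_mul_exp_neg_rpow_neg hα0 one_pos hb).const_mul α
    simp only [neg_mul (1 : ℝ), one_mul] at this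
    exact this
  have key := integral_Ioi_of_hasDerivAt_of_tendsto (a := 0) (m := 0)
    (f := fun r : ℝ => r ^ d * (1 - Real.exp (-r ^ (-α))))
    (f' := fun r : ℝ => d * (r ^ (d - 1) * (1 - Real.exp (-r ^ (-α)))) -
      α * (r ^ (-α * ((α - d) / α) - 1) * Real.exp (-r ^ (-α)))) ?_ ?_ (hInt1.sub hInt2) ?_
  · rw [integral_sub hInt1 hInt2, integral_const_mul, integral_const_mul,
      integral_rpow_mul_exp_neg_rpow_neg hα0 hb, mul_div_cancel₀ _ hα0.ne'] at key
    have h0 : (0 : ℝ) ^ d = 0 := zero_pow (by omega)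
    rw [h0, zero_mul, sub_zero] at key
    linarith
  · have h0 : (0 : ℝ) ^ d = 0 := zero_pow (by omega)
    have hlim : Filter.Tendsto (fun r : ℝ => r ^ d) (nhdsWithin 0 (Set.Ici 0)) (nhds 0) := by
      have : Filter.Tendsto (fun r : ℝ => r ^ d) (nhds 0) (nhds (0 ^ d)) :=
        (continuous_pow d).tendsto 0
      rw [h0] at this
      exact this.mono_left nhdsWithin_le_nhds
    rw [ContinuousWithinAt, h0, zero_mul]
    refine tendsto_of_tendsto_of_tendsto_of_le_of_le' tendsto_const_nhds hlim ?_ ?_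
    · filter_upwards [self_mem_nhdsWithin] with r hr
      exact mul_nonneg (pow_nonneg hr _) (one_sub_exp_neg_nonneg (Real.rpow_nonneg hr _))
    · filter_upwards [self_mem_nhdsWithin] with r hr
      have := Real.exp_pos (-r ^ (-α))
      exact mul_le_of_le_one_right (pow_nonneg hr _) (by linarith)
  · intro r hr
    have hr : 0 < r := hr
    have h1 : HasDerivAt (fun r : ℝ => r ^ (-α)) (-α * r ^ (-α - 1)) r :=
      Real.hasDerivAt_rpow_const (Or.inl hr.ne')
    have h2 := (hasDerivAt_pow d r).mul (h1.neg.exp.const_sub 1)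
    refine h2.congr_deriv ?_
    have h3 : r ^ (-α * ((α - d) / α) - 1) = r ^ d * r ^ (-α - 1) := by
      rw [← Real.rpow_natCast, ← Real.rpow_add hr]
      congr 1
      field_simp
      ring
    rw [h3]
    simp only [Pi.neg_apply]
    ring
  · have hlim : Filter.Tendsto (fun r : ℝ => r ^ (-(α - d))) Filter.atTop (nhds 0) :=
      tendsto_rpow_neg_atTop (sub_pos.2 hα)
    refine tendsto_of_tendsto_of_tendsto_of_le_of_le' tendsto_const_nhds hlim ?_ ?_
    · filter_upwards [Filter.eventually_gt_atTop 0] with r hr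
      exact mul_nonneg (pow_nonneg hr.le _) (one_sub_exp_neg_nonneg (Real.rpow_nonneg hr.le _))
    · filter_upwards [Filter.eventually_gt_atTop 0] with r hr
      rw [neg_sub, sub_eq_add_neg (d : ℝ), Real.rpow_add hr, Real.rpow_natCast]
      exact mul_le_mul_of_nonneg_left (one_sub_exp_neg_le _) (pow_nonneg hr.le _)

lemma integrable_one_sub_exp_neg_norm_rpow {d : ℕ} (hd : 1 ≤ d) {α : ℝ} (hα : (d : ℝ) < α) :
    Integrable (fun x : EuclideanSpace ℝ (Fin d) => 1 - Real.exp (-‖x‖ ^ (-α))) := by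
  have := nontrivial_euclideanSpace_fin hd
  rw [integrable_fun_norm_addHaar volume (f := fun r : ℝ => 1 - Real.exp (-r ^ (-α)))]
  simpa using integrableOn_pow_mul_one_sub_exp hd hα

lemma integral_one_sub_exp_neg_norm_rpow {d : ℕ} (hd : 1 ≤ d) {α : ℝ} (hα : (d : ℝ) < α) :
    ∫ x : EuclideanSpace ℝ (Fin d), (1 - Real.exp (-‖x‖ ^ (-α))) = a1 d α := by
  have := nontrivial_euclideanSpace_fin hd
  rw [integral_fun_norm_addHaar volume (fun r : ℝ => 1 - Real.exp (-r ^ (-α))), a1,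
    ← integral_pow_mul_one_sub_exp hd hα]
  simp only [smul_eq_mul, finrank_euclideanSpace, Fintype.card_fin, nsmul_eq_mul, omegaD,
    Measure.real]
  ring

/-- The second moment of a radial density is isotropic. -/
lemma integral_radial_mul_inner_sq {d : ℕ} (hd : 1 ≤ d) {g : ℝ → ℝ} (hg : Measurable g)
    (hInt : Integrable (fun x : EuclideanSpace ℝ (Fin d) => g ‖x‖ * ‖x‖ ^ 2))
    (z : EuclideanSpace ℝ (Fin d)) :
    Integrable (fun x : EuclideanSpace ℝ (Fin d) => g ‖x‖ * inner ℝ x z ^ 2) ∧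
    ∫ x : EuclideanSpace ℝ (Fin d), g ‖x‖ * inner ℝ x z ^ 2 =
      ‖z‖ ^ 2 / d * ∫ x : EuclideanSpace ℝ (Fin d), g ‖x‖ * ‖x‖ ^ 2 := by
  have hd0 : (0 : ℝ) < d := by exact_mod_cast hd
  have hI : ∀ z : EuclideanSpace ℝ (Fin d),
      Integrable (fun x : EuclideanSpace ℝ (Fin d) => g ‖x‖ * inner ℝ x z ^ 2) := by
    intro z
    refine Integrable.mono' (hInt.norm.mul_const (‖z‖ ^ 2)) (by fun_prop) (ae_of_all _ fun x => ?_)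
    rw [norm_mul, norm_mul, mul_assoc]
    refine mul_le_mul_of_nonneg_left ?_ (norm_nonneg _)
    rw [norm_pow, norm_pow, norm_norm, ← mul_pow]
    exact pow_le_pow_left₀ (norm_nonneg _) (norm_inner_le_norm x z) 2
  have hinv : ∀ v w : EuclideanSpace ℝ (Fin d), ‖v‖ = ‖w‖ →
      ∫ x : EuclideanSpace ℝ (Fin d), g ‖x‖ * inner ℝ x v ^ 2 =
        ∫ x : EuclideanSpace ℝ (Fin d), g ‖x‖ * inner ℝ x w ^ 2 := by
    intro v w hvw
    set R := (Submodule.span ℝ {v - w})ᗮ.reflection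
    have hRv : R v = w := Submodule.reflection_sub hvw
    rw [← R.measurePreserving.integral_comp' (f := R.toHomeomorph.toMeasurableEquiv)
      (fun x => g ‖x‖ * inner ℝ x w ^ 2)]
    refine integral_congr_ae (ae_of_all _ fun x => ?_)
    change g ‖x‖ * inner ℝ x v ^ 2 = g ‖R x‖ * inner ℝ (R x) w ^ 2
    rw [← hRv, R.norm_map, R.inner_map_map]
  refine ⟨hI z, ?_⟩
  let b := EuclideanSpace.basisFun (Fin d) ℝ
  have hb : ∀ i, ∫ x : EuclideanSpace ℝ (Fin d), g ‖x‖ * inner ℝ x z ^ 2 =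
      ‖z‖ ^ 2 * ∫ x : EuclideanSpace ℝ (Fin d), g ‖x‖ * inner ℝ x (b i) ^ 2 := by
    intro i
    rw [hinv z (‖z‖ • b i) (by simp [norm_smul]), ← integral_const_mul]
    refine integral_congr_ae (ae_of_all _ fun x => ?_)
    simp only [inner_smul_right]
    ring
  have hsum : ∫ x : EuclideanSpace ℝ (Fin d), g ‖x‖ * ‖x‖ ^ 2 =
      ∑ i, ∫ x : EuclideanSpace ℝ (Fin d), g ‖x‖ * inner ℝ x (b i) ^ 2 := by
    rw [← integral_finsetSum _ (fun i _ => hI (b i))]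
    refine integral_congr_ae (ae_of_all _ fun x => ?_)
    simp only
    rw [← b.sum_sq_norm_inner_right x, Finset.mul_sum]
    simp [real_inner_comm]
  have htot : (d : ℝ) * ∫ x : EuclideanSpace ℝ (Fin d), g ‖x‖ * inner ℝ x z ^ 2 =
      ‖z‖ ^ 2 * ∫ x : EuclideanSpace ℝ (Fin d), g ‖x‖ * ‖x‖ ^ 2 := by
    rw [hsum, Finset.mul_sum, ← Finset.sum_congr rfl (fun i _ => hb i)]
    simp
  field_simp
  linarith

lemma exists_one_add_rpow_taylor (a : ℝ) : ∃ c > 0, c < 1 ∧ ∃ K > 0, ∀ w : ℝ, |w| ≤ c →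
    |(1 + w) ^ a - 1 - a * w - a * (a - 1) / 2 * w ^ 2| ≤ K * |w| ^ 3 := by
  have h := (Real.one_add_rpow_hasFPowerSeriesAt_zero (a := a)).isBigO_sub_partialSum_pow 3
  obtain ⟨K, hK, hb⟩ := h.exists_pos
  obtain ⟨c, hc, hball⟩ := Metric.eventually_nhds_iff.1 hb.bound
  refine ⟨min (c / 2) (1 / 2), by positivity, by
    have := min_le_right (c / 2) (1 / 2); linarith, K, hK, fun w hw => ?_⟩
  have hwc : dist w 0 < c := by
    have := min_le_left (c / 2) (1 / 2)
    rw [Real.dist_eq, sub_zero]; linarith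
  have := hball hwc
  simp only [zero_add, Real.norm_eq_abs, abs_pow, abs_abs] at this
  convert this using 2
  simp [FormalMultilinearSeries.partialSum, Finset.sum_range_succ, binomialSeries,
    Ring.choose_eq_smul, descPochhammer_succ_right, Polynomial.smeval_mul,
    Polynomial.smeval_sub]
  ring

/-- The quadratic term in `z` of the expansion of `|z - x|^{-α}` around `z = 0`. -/
noncomputable def quadKernel {d : ℕ} (α : ℝ) (x z : EuclideanSpace ℝ (Fin d)) : ℝ :=
  ‖x‖ ^ (-α) * (α * (α + 2) / 2 * (inner ℝ x z / ‖x‖ ^ 2) ^ 2 - α / 2 * (‖z‖ / ‖x‖) ^ 2)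

lemma abs_inner_div_norm_sq_le {d : ℕ} (x z : EuclideanSpace ℝ (Fin d)) :
    |inner ℝ x z / ‖x‖ ^ 2| ≤ ‖z‖ / ‖x‖ := by
  rcases eq_or_ne x 0 with rfl | hx
  · simp
  have hr : 0 < ‖x‖ := norm_pos_iff.2 hx
  rw [abs_div, abs_of_pos (pow_pos hr 2), div_le_div_iff₀ (pow_pos hr 2) hr]
  nlinarith [mul_le_mul_of_nonneg_right (abs_real_inner_le_norm x z) hr.le]

lemma abs_quadKernel_le {d : ℕ} {α : ℝ} (hα : 0 < α) (x z : EuclideanSpace ℝ (Fin d)) :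
    |quadKernel α x z| ≤ α * (α + 3) / 2 * (‖x‖ ^ (-α) * (‖z‖ / ‖x‖) ^ 2) := by
  have hf : 0 ≤ ‖x‖ ^ (-α) := Real.rpow_nonneg (norm_nonneg _) _
  have hp := sq_le_sq' (neg_le_of_abs_le (abs_inner_div_norm_sq_le x z))
    (le_of_abs_le (abs_inner_div_norm_sq_le x z))
  set p := inner ℝ x z / ‖x‖ ^ 2
  rw [quadKernel, abs_mul, abs_of_nonneg hf,
    show α * (α + 3) / 2 * (‖x‖ ^ (-α) * (‖z‖ / ‖x‖) ^ 2) =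
      ‖x‖ ^ (-α) * (α * (α + 3) / 2 * (‖z‖ / ‖x‖) ^ 2) by ring]
  refine mul_le_mul_of_nonneg_left ?_ hf
  have h1 : 0 ≤ α * (α + 2) / 2 := by positivity
  have h2 := mul_le_mul_of_nonneg_left hp h1
  have h3 : 0 ≤ α * (α + 2) / 2 * p ^ 2 := by positivity
  have h4 : 0 ≤ α / 2 * (‖z‖ / ‖x‖) ^ 2 := by positivity
  rw [abs_le]
  constructor <;> nlinarith

lemma measurable_quadKernel {d : ℕ} (α : ℝ) :
    Measurable (fun q : EuclideanSpace ℝ (Fin d) × EuclideanSpace ℝ (Fin d) =>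
      quadKernel α q.1 q.2) := by
  unfold quadKernel
  fun_prop

lemma exists_norm_sub_rpow_taylor {α : ℝ} (hα : 0 < α) : ∃ c > 0, c ≤ 1 / 2 ∧ ∃ K > 0,
    ∀ (d : ℕ) (x z : EuclideanSpace ℝ (Fin d)), x ≠ 0 → ‖z‖ ≤ c * ‖x‖ →
      |‖z - x‖ ^ (-α) - ‖x‖ ^ (-α) - α * ‖x‖ ^ (-α) * (inner ℝ x z / ‖x‖ ^ 2)
        - quadKernel α x z| ≤ K * (‖x‖ ^ (-α) * (‖z‖ / ‖x‖) ^ 3) := by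
  obtain ⟨c, hc, hc1, K, hK, hT⟩ := exists_one_add_rpow_taylor (-α / 2)
  refine ⟨c / 3, by positivity, by linarith, 27 * K + 5 * (α * (α + 2) / 8), by positivity,
    fun d x z hx hz => ?_⟩
  have hr : 0 < ‖x‖ := norm_pos_iff.2 hx
  have hf : 0 ≤ ‖x‖ ^ (-α) := Real.rpow_nonneg (norm_nonneg _) _
  have hp := abs_inner_div_norm_sq_le x z
  have hu0 : 0 ≤ ‖z‖ / ‖x‖ := by positivity
  have huc : ‖z‖ / ‖x‖ ≤ c / 3 := (div_le_iff₀ hr).2 hz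
  have hsq : ‖z - x‖ ^ 2 = ‖x‖ ^ 2 * (1 + ((‖z‖ / ‖x‖) ^ 2 - 2 * (inner ℝ x z / ‖x‖ ^ 2))) := by
    rw [norm_sub_sq_real, real_inner_comm]
    field_simp
    ring
  unfold quadKernel
  set p := inner ℝ x z / ‖x‖ ^ 2
  set u := ‖z‖ / ‖x‖
  set w := u ^ 2 - 2 * p with hw
  have hw3 : |w| ≤ 3 * u := by
    rw [abs_le] at hp ⊢
    constructor <;> nlinarith
  have hwc : |w| ≤ c := by linarith
  have h1w : 0 ≤ 1 + w := by have := neg_le_of_abs_le hwc; linarith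
  have hker : ‖z - x‖ ^ (-α) = ‖x‖ ^ (-α) * (1 + w) ^ (-α / 2) := by
    have e : ∀ s : ℝ, 0 ≤ s → s ^ (-α) = (s ^ 2) ^ (-α / 2) := fun s hs => by
      rw [← Real.rpow_natCast, ← Real.rpow_mul hs]
      congr 1
      push_cast
      ring
    rw [e _ (norm_nonneg _), hsq, Real.mul_rpow (by positivity) h1w, ← e _ hr.le]
  have hdiff : |w ^ 2 - 4 * p ^ 2| ≤ 5 * u ^ 3 := by
    rw [show w ^ 2 - 4 * p ^ 2 = u ^ 2 * (u ^ 2 - 4 * p) by rw [hw]; ring, abs_mul,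
      abs_of_nonneg (sq_nonneg u), show 5 * u ^ 3 = u ^ 2 * (5 * u) by ring]
    refine mul_le_mul_of_nonneg_left ?_ (sq_nonneg u)
    rw [abs_le] at hp ⊢
    constructor <;> nlinarith
  have hcub : |w| ^ 3 ≤ 27 * u ^ 3 := by
    calc |w| ^ 3 ≤ (3 * u) ^ 3 := pow_le_pow_left₀ (abs_nonneg _) hw3 3
      _ = 27 * u ^ 3 := by ring
  have hmain := hT w hwc
  have hc8 : 0 ≤ α * (α + 2) / 8 := by positivity
  rw [hker, show ‖x‖ ^ (-α) * (1 + w) ^ (-α / 2) - ‖x‖ ^ (-α) - α * ‖x‖ ^ (-α) * p -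
      ‖x‖ ^ (-α) * (α * (α + 2) / 2 * p ^ 2 - α / 2 * u ^ 2) =
      ‖x‖ ^ (-α) * (((1 + w) ^ (-α / 2) - 1 - -α / 2 * w - -α / 2 * (-α / 2 - 1) / 2 * w ^ 2)
        + α * (α + 2) / 8 * (w ^ 2 - 4 * p ^ 2)) by rw [hw]; ring, abs_mul, abs_of_nonneg hf,
    mul_left_comm]
  refine mul_le_mul_of_nonneg_left ((abs_add_le _ _).trans ?_) hf
  rw [abs_mul, abs_of_nonneg hc8]
  have h1 := mul_le_mul_of_nonneg_left hdiff hc8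
  have h2 := mul_le_mul_of_nonneg_left hcub hK.le
  linarith

/-- Second-order error in perturbing the exponent of `e^{-f}`. -/
lemma abs_exp_neg_perturb_le {f q e A B : ℝ} (hq : |q| ≤ A) (he : |e| ≤ B)
    (hAB : A + B ≤ f / 2) :
    |Real.exp (-f) - Real.exp (-(f + q + e)) - Real.exp (-f) * q| ≤
      Real.exp (-(1 / 2) * f) * ((A + B) ^ 2 + B) := by
  have hB : 0 ≤ B := (abs_nonneg e).trans he
  have hA : 0 ≤ A := (abs_nonneg q).trans hq
  have hqe : |q + e| ≤ A + B := (abs_add_le q e).trans (add_le_add hq he)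
  have hexp : |Real.exp (-(q + e)) - 1 + (q + e)| ≤ (A + B) ^ 2 * Real.exp (f / 2) := by
    have h := Complex.norm_exp_sub_sum_le_norm_mul_exp ((-(q + e) : ℝ) : ℂ) 2
    rw [Complex.norm_real, Real.norm_eq_abs, abs_neg] at h
    have h' : |Real.exp (-(q + e)) - 1 + (q + e)| ≤ |q + e| ^ 2 * Real.exp |q + e| := by
      convert h using 1
      rw [← Real.norm_eq_abs, ← Complex.norm_real]
      congr 1
      simp [Finset.sum_range_succ]
      ring
    refine h'.trans (mul_le_mul (pow_le_pow_left₀ (abs_nonneg _) hqe 2)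
      (Real.exp_le_exp.2 (hqe.trans hAB)) (Real.exp_pos _).le (sq_nonneg _))
  have hfac : Real.exp (-f) - Real.exp (-(f + q + e)) - Real.exp (-f) * q =
      Real.exp (-f) * (e - (Real.exp (-(q + e)) - 1 + (q + e))) := by
    rw [show -(f + q + e) = -f + -(q + e) by ring, Real.exp_add]
    ring
  have hhalf : Real.exp (-f) * Real.exp (f / 2) = Real.exp (-(1 / 2) * f) := by
    rw [← Real.exp_add]; congr 1; ring
  have hle : Real.exp (-f) ≤ Real.exp (-(1 / 2) * f) := Real.exp_le_exp.2 (by linarith)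
  rw [hfac, abs_mul, abs_of_pos (Real.exp_pos _)]
  calc Real.exp (-f) * |e - (Real.exp (-(q + e)) - 1 + (q + e))|
      ≤ Real.exp (-f) * (B + (A + B) ^ 2 * Real.exp (f / 2)) :=
        mul_le_mul_of_nonneg_left ((abs_sub _ _).trans (add_le_add he hexp)) (Real.exp_pos _).le
    _ = Real.exp (-f) * B + (A + B) ^ 2 * Real.exp (-(1 / 2) * f) := by rw [← hhalf]; ring
    _ ≤ Real.exp (-(1 / 2) * f) * ((A + B) ^ 2 + B) := by
        have := mul_le_mul_of_nonneg_right hle hB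
        linarith

lemma rpow_neg_two_mul_add_four (α : ℝ) {r : ℝ} (hr : 0 < r) :
    r ^ (-(2 * α + 4)) = (r ^ (-α)) ^ 2 / r ^ 4 := by
  rw [← Real.rpow_natCast, ← Real.rpow_mul hr.le, ← Real.rpow_natCast, ← Real.rpow_sub hr]
  congr 1
  push_cast
  ring

lemma rpow_neg_add_three (α : ℝ) {r : ℝ} (hr : 0 < r) :
    r ^ (-(α + 3)) = r ^ (-α) / r ^ 3 := by
  rw [← Real.rpow_natCast, ← Real.rpow_sub hr]
  congr 1
  push_cast
  ring

lemma perturbation_size_bounds {f V r ρ c η M K : ℝ} (hf : 0 < f) (hV0 : 0 ≤ V) (hVρ : V ≤ ρ ^ 2)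
    (hr : 0 < r) (hρ0 : 0 ≤ ρ) (hρr : ρ ≤ c * r) (hρη : ρ ≤ η) (hη : 0 < η) (hη1 : η ≤ 1)
    (hc : c ≤ 1 / 2) (hM : 0 < M) (hK : 0 < K) (hcK : (M + K) * c ^ 2 ≤ 1 / 2) :
    M * (f * (V / r ^ 2)) + K * (f * (ρ / r) * (V / r ^ 2)) ≤ f / 2 ∧
    (M * (f * (V / r ^ 2)) + K * (f * (ρ / r) * (V / r ^ 2))) ^ 2 +
        K * (f * (ρ / r) * (V / r ^ 2)) ≤
      ((M + K) ^ 2 + K) * η * V * (f ^ 2 / r ^ 4 + f / r ^ 3) := by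
  have hρr : ρ / r ≤ c := (div_le_iff₀ hr).2 hρr
  have hVr : V / r ^ 2 ≤ (ρ / r) ^ 2 := by
    rw [div_pow]; exact div_le_div_of_nonneg_right hVρ (by positivity)
  have hρr0 : 0 ≤ ρ / r := by positivity
  have hAB : M * (f * (V / r ^ 2)) + K * (f * (ρ / r) * (V / r ^ 2)) ≤
      (M + K) * (f * (V / r ^ 2)) := by
    have : K * (f * (V / r ^ 2)) * (ρ / r) ≤ K * (f * (V / r ^ 2)) * 1 :=
      mul_le_mul_of_nonneg_left (by linarith) (by positivity)
    linarith
  have hAB2 : (M + K) * (f * (V / r ^ 2)) ≤ f / 2 := by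
    have h1 : V / r ^ 2 ≤ c ^ 2 := hVr.trans (pow_le_pow_left₀ hρr0 hρr 2)
    have h2 := mul_le_mul_of_nonneg_left h1 (by positivity : 0 ≤ (M + K) * f)
    have h3 := mul_le_mul_of_nonneg_left hcK hf.le
    linarith
  have b1 : (M * (f * (V / r ^ 2)) + K * (f * (ρ / r) * (V / r ^ 2))) ^ 2 ≤
      (M + K) ^ 2 * η * V * (f ^ 2 / r ^ 4) := by
    calc _ ≤ ((M + K) * (f * (V / r ^ 2))) ^ 2 := pow_le_pow_left₀ (by positivity) hAB 2
      _ = (M + K) ^ 2 * V * (f ^ 2 / r ^ 4) * V := by field_simp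
      _ ≤ (M + K) ^ 2 * V * (f ^ 2 / r ^ 4) * η :=
          mul_le_mul_of_nonneg_left (hVρ.trans (by nlinarith)) (by positivity)
      _ = _ := by ring
  have b2 : K * (f * (ρ / r) * (V / r ^ 2)) ≤ K * η * V * (f / r ^ 3) := by
    calc K * (f * (ρ / r) * (V / r ^ 2)) = K * V * (f / r ^ 3) * ρ := by field_simp
      _ ≤ K * V * (f / r ^ 3) * η := mul_le_mul_of_nonneg_left hρη (by positivity)
      _ = _ := by ring
  refine ⟨hAB.trans hAB2, ?_⟩
  have p1 : 0 ≤ (M + K) ^ 2 * η * V * (f / r ^ 3) := by positivity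
  have p2 : 0 ≤ K * η * V * (f ^ 2 / r ^ 4) := by positivity
  linarith

section Perturbation

variable {d : ℕ} {ν : Measure (EuclideanSpace ℝ (Fin d))} [IsProbabilityMeasure ν] {ρ : ℝ}

lemma integrable_of_ae_norm_le {g : EuclideanSpace ℝ (Fin d) → ℝ} (hg : Measurable g) {B : ℝ}
    (hB : ∀ᵐ z ∂ν, |g z| ≤ B) : Integrable g ν :=
  Integrable.mono' (integrable_const B) hg.aestronglyMeasurable hB

lemma integrable_norm_pow (hν : ∀ᵐ z ∂ν, ‖z‖ ≤ ρ) (n : ℕ) :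
    Integrable (fun z : EuclideanSpace ℝ (Fin d) => ‖z‖ ^ n) ν := by
  refine integrable_of_ae_norm_le (by fun_prop) (B := ρ ^ n) ?_
  filter_upwards [hν] with z hz
  rw [abs_of_nonneg (by positivity)]
  exact pow_le_pow_left₀ (norm_nonneg _) hz n

lemma integrable_id_of_ae_norm_le (hν : ∀ᵐ z ∂ν, ‖z‖ ≤ ρ) :
    Integrable (fun z : EuclideanSpace ℝ (Fin d) => z) ν :=
  Integrable.mono' (integrable_const ρ) measurable_id.aestronglyMeasurable hν

lemma integral_norm_sq_le (hν : ∀ᵐ z ∂ν, ‖z‖ ≤ ρ) : ∫ z, ‖z‖ ^ 2 ∂ν ≤ ρ ^ 2 := by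
  have := integral_mono_ae (integrable_norm_pow hν 2) (integrable_const (ρ ^ 2))
    (by filter_upwards [hν] with z hz using pow_le_pow_left₀ (norm_nonneg _) hz 2)
  simpa using this

lemma integrable_quadKernel {α : ℝ} (hα : 0 < α) (hν : ∀ᵐ z ∂ν, ‖z‖ ≤ ρ)
    (x : EuclideanSpace ℝ (Fin d)) : Integrable (fun z => quadKernel α x z) ν := by
  refine Integrable.mono' (((integrable_norm_pow hν 2).const_mul
    (α * (α + 3) / 2 * (‖x‖ ^ (-α) / ‖x‖ ^ 2))))
    ((measurable_quadKernel α).comp measurable_prodMk_left).aestronglyMeasurable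
    (ae_of_all _ fun z => (abs_quadKernel_le hα x z).trans_eq ?_)
  rw [div_pow]
  ring

lemma abs_integral_quadKernel_le {α : ℝ} (hα : 0 < α) (hν : ∀ᵐ z ∂ν, ‖z‖ ≤ ρ)
    (x : EuclideanSpace ℝ (Fin d)) :
    |∫ z, quadKernel α x z ∂ν| ≤
      α * (α + 3) / 2 * (‖x‖ ^ (-α) * ((∫ z, ‖z‖ ^ 2 ∂ν) / ‖x‖ ^ 2)) := by
  have h := norm_integral_le_of_norm_le ((integrable_norm_pow hν 2).const_mul
    (α * (α + 3) / 2 * (‖x‖ ^ (-α) / ‖x‖ ^ 2))) (f := fun z => quadKernel α x z)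
    (ae_of_all _ fun z => (abs_quadKernel_le hα x z).trans_eq (by rw [div_pow]; ring))
  rw [integral_const_mul] at h
  refine h.trans_eq ?_
  ring

lemma abs_integral_norm_sub_rpow_sub_le {α c K : ℝ} (hα : 0 < α) (hK : 0 < K) (hc : c ≤ 1 / 2)
    (hT : ∀ x z : EuclideanSpace ℝ (Fin d), x ≠ 0 → ‖z‖ ≤ c * ‖x‖ →
      |‖z - x‖ ^ (-α) - ‖x‖ ^ (-α) - α * ‖x‖ ^ (-α) * (inner ℝ x z / ‖x‖ ^ 2)
        - quadKernel α x z| ≤ K * (‖x‖ ^ (-α) * (‖z‖ / ‖x‖) ^ 3))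
    (hν : ∀ᵐ z ∂ν, ‖z‖ ≤ ρ) (hm : ∫ z, z ∂ν = 0) {x : EuclideanSpace ℝ (Fin d)} (hx : x ≠ 0)
    (hρ : ρ ≤ c * ‖x‖) :
    |(∫ z, ‖z - x‖ ^ (-α) ∂ν) - ‖x‖ ^ (-α) - ∫ z, quadKernel α x z ∂ν| ≤
      K * (‖x‖ ^ (-α) * (ρ / ‖x‖) * ((∫ z, ‖z‖ ^ 2 ∂ν) / ‖x‖ ^ 2)) := by
  have hr : 0 < ‖x‖ := norm_pos_iff.2 hx
  have hf : 0 ≤ ‖x‖ ^ (-α) := Real.rpow_nonneg (norm_nonneg _) _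
  have hz := integrable_id_of_ae_norm_le hν
  have i1 : Integrable (fun z : EuclideanSpace ℝ (Fin d) => ‖z - x‖ ^ (-α)) ν := by
    refine integrable_of_ae_norm_le (by fun_prop) (B := (‖x‖ / 2) ^ (-α)) ?_
    filter_upwards [hν] with z hz
    rw [abs_of_nonneg (Real.rpow_nonneg (norm_nonneg _) _)]
    refine Real.rpow_le_rpow_of_nonpos (by positivity) ?_ (by linarith)
    have h1 := norm_sub_norm_le x z
    rw [norm_sub_rev] at h1
    nlinarith
  have i2 : Integrable (fun z : EuclideanSpace ℝ (Fin d) =>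
      α * ‖x‖ ^ (-α) * (inner ℝ x z / ‖x‖ ^ 2)) ν :=
    ((hz.const_inner x).div_const _).const_mul _
  have i3 := integrable_quadKernel hα hν x
  have hlin : ∫ z, α * ‖x‖ ^ (-α) * (inner ℝ x z / ‖x‖ ^ 2) ∂ν = 0 := by
    rw [integral_const_mul, integral_div, integral_inner hz, hm]
    simp
  have hsplit : (∫ z, ‖z - x‖ ^ (-α) ∂ν) - ‖x‖ ^ (-α) - ∫ z, quadKernel α x z ∂ν =
      ∫ z, (‖z - x‖ ^ (-α) - ‖x‖ ^ (-α) - α * ‖x‖ ^ (-α) * (inner ℝ x z / ‖x‖ ^ 2)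
        - quadKernel α x z) ∂ν := by
    have i0 : Integrable (fun _ : EuclideanSpace ℝ (Fin d) => ‖x‖ ^ (-α)) ν := integrable_const _
    have j1 : Integrable (fun z : EuclideanSpace ℝ (Fin d) => ‖z - x‖ ^ (-α) - ‖x‖ ^ (-α)) ν :=
      i1.sub i0
    have j2 : Integrable (fun z : EuclideanSpace ℝ (Fin d) => ‖z - x‖ ^ (-α) - ‖x‖ ^ (-α) -
      α * ‖x‖ ^ (-α) * (inner ℝ x z / ‖x‖ ^ 2)) ν := j1.sub i2
    rw [integral_sub j2 i3, integral_sub j1 i2, integral_sub i1 i0, hlin]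
    simp
  rw [hsplit, ← Real.norm_eq_abs]
  refine (norm_integral_le_of_norm_le ((integrable_norm_pow hν 2).const_mul
    (K * (‖x‖ ^ (-α) * (ρ / ‖x‖) / ‖x‖ ^ 2))) ?_).trans_eq ?_
  · filter_upwards [hν] with z hz
    refine (hT x z hx (hz.trans hρ)).trans ?_
    rw [show K * (‖x‖ ^ (-α) * (‖z‖ / ‖x‖) ^ 3) =
        K * ‖x‖ ^ (-α) / ‖x‖ ^ 3 * ‖z‖ ^ 2 * ‖z‖ by field_simp,
      show K * (‖x‖ ^ (-α) * (ρ / ‖x‖) / ‖x‖ ^ 2) * ‖z‖ ^ 2 =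
        K * ‖x‖ ^ (-α) / ‖x‖ ^ 3 * ‖z‖ ^ 2 * ρ by field_simp]
    exact mul_le_mul_of_nonneg_left hz (by positivity)
  · rw [integral_const_mul]
    ring

/-- The integrable profile dominating the error of the quadratic approximation. -/
noncomputable def errorProfile (d : ℕ) (α : ℝ) (x : EuclideanSpace ℝ (Fin d)) : ℝ :=
  (‖x‖ ^ (-(2 * α + 4)) + ‖x‖ ^ (-(α + 3))) * Real.exp (-(1 / 2) * ‖x‖ ^ (-α))

lemma errorProfile_nonneg (α : ℝ) (x : EuclideanSpace ℝ (Fin d)) : 0 ≤ errorProfile d α x := by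
  have h := Real.rpow_nonneg (norm_nonneg x)
  exact mul_nonneg (add_nonneg (h _) (h _)) (Real.exp_pos _).le

lemma integrable_errorProfile (hd : 1 ≤ d) {α : ℝ} (hα : (d : ℝ) < α) :
    Integrable (errorProfile d α) := by
  have hα0 : 0 < α := (Nat.cast_nonneg d).trans_lt hα
  have h := (integrable_norm_rpow_mul_exp hd hα0 (a := 1 / 2) (p := 2 * α + 4) (by norm_num)
    (by linarith)).add (integrable_norm_rpow_mul_exp hd hα0 (a := 1 / 2) (p := α + 3)
    (by norm_num) (by linarith))
  refine h.congr (ae_of_all _ fun x => ?_)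
  simp only [errorProfile, Pi.add_apply]
  ring

lemma far_field_bound {α c K η t : ℝ} (hα : 0 < α) (hK : 0 < K) (hc0 : 0 < c) (hc : c ≤ 1 / 2)
    (hcK : (α * (α + 3) / 2 + K) * c ^ 2 ≤ 1 / 2)
    (hT : ∀ x z : EuclideanSpace ℝ (Fin d), x ≠ 0 → ‖z‖ ≤ c * ‖x‖ →
      |‖z - x‖ ^ (-α) - ‖x‖ ^ (-α) - α * ‖x‖ ^ (-α) * (inner ℝ x z / ‖x‖ ^ 2)
        - quadKernel α x z| ≤ K * (‖x‖ ^ (-α) * (‖z‖ / ‖x‖) ^ 3))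
    (hη : 0 < η) (hη1 : η ≤ 1) (hρ0 : 0 ≤ ρ) (hρ : ρ ≤ c * η) (ht : (η / 2) ^ (-α) ≤ t)
    (hν : ∀ᵐ z ∂ν, ‖z‖ ≤ ρ) (hm : ∫ z, z ∂ν = 0) {x : EuclideanSpace ℝ (Fin d)}
    (hx : η < ‖x‖) :
    |Real.exp (-‖x‖ ^ (-α)) - Real.exp (-∫ z, min (‖z - x‖ ^ (-α)) t ∂ν)
      - Real.exp (-‖x‖ ^ (-α)) * ∫ z, quadKernel α x z ∂ν| ≤
      ((α * (α + 3) / 2 + K) ^ 2 + K) * η * (∫ z, ‖z‖ ^ 2 ∂ν) * errorProfile d α x := by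
  have hr : 0 < ‖x‖ := hη.trans hx
  have hx0 : x ≠ 0 := norm_pos_iff.1 hr
  have hf : 0 < ‖x‖ ^ (-α) := Real.rpow_pos_of_pos hr _
  have hρx : ρ ≤ c * ‖x‖ := hρ.trans (mul_le_mul_of_nonneg_left hx.le hc0.le)
  have hρη : ρ ≤ η := by nlinarith
  have hmin : ∫ z, min (‖z - x‖ ^ (-α)) t ∂ν = ∫ z, ‖z - x‖ ^ (-α) ∂ν := by
    refine integral_congr_ae ?_
    filter_upwards [hν] with z hz
    refine min_eq_left (le_trans ?_ ht)
    refine Real.rpow_le_rpow_of_nonpos (by positivity) ?_ (by linarith)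
    have h1 := norm_sub_norm_le x z
    rw [norm_sub_rev] at h1
    nlinarith
  have hV0 : 0 ≤ ∫ z, ‖z‖ ^ 2 ∂ν := integral_nonneg fun z => by positivity
  have hsize := perturbation_size_bounds hf hV0 (integral_norm_sq_le hν) hr hρ0 hρx hρη hη hη1 hc
    (by positivity : 0 < α * (α + 3) / 2) hK hcK
  have hmain := abs_exp_neg_perturb_le (abs_integral_quadKernel_le hα hν x)
    (abs_integral_norm_sub_rpow_sub_le hα hK hc hT hν hm hx0 hρx) hsize.1
  rw [sub_sub (∫ z, ‖z - x‖ ^ (-α) ∂ν), add_sub_cancel] at hmain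
  rw [hmin]
  refine (hmain.trans (mul_le_mul_of_nonneg_left hsize.2 (Real.exp_pos _).le)).trans_eq ?_
  rw [errorProfile, rpow_neg_two_mul_add_four α hr, rpow_neg_add_three α hr]
  ring

lemma near_field_bound {α c η t : ℝ} (hα : 0 < α) (hc : c ≤ 1 / 2)
    (hη : 0 < η) (hρ : ρ ≤ c * η) (ht : (η / 2) ^ (-α) ≤ t)
    (hν : ∀ᵐ z ∂ν, ‖z‖ ≤ ρ) {x : EuclideanSpace ℝ (Fin d)}
    (hx : ‖x‖ ≤ η) (hx0 : x ≠ 0) (hνx : ν {x} = 0) :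
    |Real.exp (-‖x‖ ^ (-α)) - Real.exp (-∫ z, min (‖z - x‖ ^ (-α)) t ∂ν)
      - Real.exp (-‖x‖ ^ (-α)) * ∫ z, quadKernel α x z ∂ν| ≤
      α * (α + 3) / 2 * η * (∫ z, ‖z‖ ^ 2 ∂ν) * errorProfile d α x +
        2 * Real.exp (-(2 * η) ^ (-α)) := by
  have hr : 0 < ‖x‖ := norm_pos_iff.2 hx0
  have hf : 0 < ‖x‖ ^ (-α) := Real.rpow_pos_of_pos hr _
  have h1 : (2 * η) ^ (-α) ≤ ‖x‖ ^ (-α) :=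
    Real.rpow_le_rpow_of_nonpos hr (by linarith) (by linarith)
  have ht0 : 0 ≤ t := (Real.rpow_nonneg (by positivity) _).trans ht
  have h2 : (2 * η) ^ (-α) ≤ ∫ z, min (‖z - x‖ ^ (-α)) t ∂ν := by
    have hInt : Integrable (fun z : EuclideanSpace ℝ (Fin d) => min (‖z - x‖ ^ (-α)) t) ν := by
      refine integrable_of_ae_norm_le (by fun_prop) (B := t) (ae_of_all _ fun z => ?_)
      rw [abs_of_nonneg (le_min (Real.rpow_nonneg (norm_nonneg _) _) ht0)]
      exact min_le_right _ _
    have hne : ∀ᵐ z ∂ν, z ≠ x := by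
      rw [ae_iff]
      simpa using hνx
    have := integral_mono_ae (integrable_const ((2 * η) ^ (-α))) hInt (by
      filter_upwards [hν, hne] with z hz hzx
      refine le_min ?_ (le_trans ?_ ht)
      · refine Real.rpow_le_rpow_of_nonpos (norm_pos_iff.2 (sub_ne_zero.2 hzx)) ?_ (by linarith)
        have := norm_sub_le z x
        nlinarith
      · exact Real.rpow_le_rpow_of_nonpos (by positivity) (by linarith) (by linarith))
    simpa using this
  have hV0 : 0 ≤ ∫ z, ‖z‖ ^ 2 ∂ν := integral_nonneg fun z => by positivity
  have hq := abs_integral_quadKernel_le hα hν x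
  have g1 := Real.exp_le_exp.2 (neg_le_neg h1)
  have g2 := Real.exp_le_exp.2 (neg_le_neg h2)
  have hqb : Real.exp (-‖x‖ ^ (-α)) * |∫ z, quadKernel α x z ∂ν| ≤
      α * (α + 3) / 2 * η * (∫ z, ‖z‖ ^ 2 ∂ν) * errorProfile d α x := by
    have hle : Real.exp (-‖x‖ ^ (-α)) ≤ Real.exp (-(1 / 2) * ‖x‖ ^ (-α)) :=
      Real.exp_le_exp.2 (by linarith)
    have hpos := Real.rpow_nonneg hr.le (-(2 * α + 4))
    refine (mul_le_mul hle hq (abs_nonneg _) (Real.exp_pos _).le).trans ?_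
    rw [errorProfile, rpow_neg_add_three α hr]
    generalize (∫ z, ‖z‖ ^ 2 ∂ν) = V at hV0
    generalize ‖x‖ ^ (-(2 * α + 4)) = g at hpos
    generalize Real.exp (-(1 / 2) * ‖x‖ ^ (-α)) = e at hle
    have he : 0 ≤ e := (Real.exp_pos _).le.trans hle
    generalize ‖x‖ ^ (-α) = f at hf
    have hstep : f * (V / ‖x‖ ^ 2) ≤ η * V * (g + f / ‖x‖ ^ 3) := by
      calc f * (V / ‖x‖ ^ 2) = V * (f / ‖x‖ ^ 3) * ‖x‖ := by field_simp
        _ ≤ V * (f / ‖x‖ ^ 3) * η := mul_le_mul_of_nonneg_left hx (by positivity)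
        _ = η * V * (f / ‖x‖ ^ 3) := by ring
        _ ≤ _ := mul_le_mul_of_nonneg_left (by linarith) (by positivity)
    calc _ ≤ e * (α * (α + 3) / 2 * (η * V * (g + f / ‖x‖ ^ 3))) :=
          mul_le_mul_of_nonneg_left (mul_le_mul_of_nonneg_left hstep (by positivity)) he
      _ = _ := by ring
  have a1' := abs_sub (Real.exp (-‖x‖ ^ (-α)) - Real.exp (-∫ z, min (‖z - x‖ ^ (-α)) t ∂ν))
    (Real.exp (-‖x‖ ^ (-α)) * ∫ z, quadKernel α x z ∂ν)
  have a2' := abs_sub (Real.exp (-‖x‖ ^ (-α))) (Real.exp (-∫ z, min (‖z - x‖ ^ (-α)) t ∂ν))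
  rw [abs_mul, abs_of_pos (Real.exp_pos _)] at a1'
  rw [abs_of_pos (Real.exp_pos _), abs_of_pos (Real.exp_pos _)] at a2'
  linarith

end Perturbation

lemma norm_rpow_div_norm_sq {d : ℕ} {α : ℝ} (hα : 0 < α) (x : EuclideanSpace ℝ (Fin d)) :
    ‖x‖ ^ (-α) / ‖x‖ ^ 2 = ‖x‖ ^ (-(α + 2)) := by
  rcases eq_or_ne x 0 with rfl | hx
  · simp [Real.zero_rpow (by linarith : -2 + -α ≠ 0)]
  have hr : 0 < ‖x‖ := norm_pos_iff.2 hx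
  rw [← Real.rpow_natCast, ← Real.rpow_sub hr]
  congr 1
  push_cast
  ring

lemma integral_exp_mul_quadKernel {d : ℕ} (hd : 1 ≤ d) {α : ℝ} (hα : (d : ℝ) < α)
    (z : EuclideanSpace ℝ (Fin d)) :
    ∫ x, Real.exp (-‖x‖ ^ (-α)) * quadKernel α x z = Cda d α * ‖z‖ ^ 2 := by
  have hd0 : (0 : ℝ) < d := by exact_mod_cast hd
  have hα0 : 0 < α := hd0.trans hα
  let g : ℝ → ℝ := fun r => Real.exp (-r ^ (-α)) * r ^ (-α) / r ^ 4
  have hg : Measurable g := by fun_prop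
  have hg2 : ∀ x : EuclideanSpace ℝ (Fin d), g ‖x‖ * ‖x‖ ^ 2 =
      ‖x‖ ^ (-(α + 2)) * Real.exp (-‖x‖ ^ (-α)) := by
    intro x
    rw [← norm_rpow_div_norm_sq hα0]
    rcases eq_or_ne x 0 with rfl | hx
    · simp
    have hr : 0 < ‖x‖ := norm_pos_iff.2 hx
    simp only [g]
    field_simp
  have hInt0 := integrable_norm_rpow_mul_exp hd hα0 one_pos (by linarith : (d : ℝ) < α + 2)
  simp only [neg_mul (1 : ℝ), one_mul] at hInt0
  have hInt : Integrable (fun x : EuclideanSpace ℝ (Fin d) => g ‖x‖ * ‖x‖ ^ 2) := by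
    simpa only [hg2] using hInt0
  obtain ⟨i1, e1⟩ := integral_radial_mul_inner_sq hd hg hInt z
  have hexp : ∀ x : EuclideanSpace ℝ (Fin d), Real.exp (-‖x‖ ^ (-α)) * quadKernel α x z =
      α * (α + 2) / 2 * (g ‖x‖ * inner ℝ x z ^ 2) -
        α / 2 * ‖z‖ ^ 2 * (g ‖x‖ * ‖x‖ ^ 2) := by
    intro x
    rcases eq_or_ne x 0 with rfl | hx
    · simp [g, quadKernel]
    have hr : 0 < ‖x‖ := norm_pos_iff.2 hx
    simp only [g, quadKernel]
    field_simp
  simp only [hexp]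
  rw [integral_sub (i1.const_mul _) (hInt.const_mul _), integral_const_mul, integral_const_mul, e1]
  simp only [hg2]
  rw [integral_norm_rpow_mul_exp hd hα0 (by linarith), Cda,
    show (2 * α - d + 2) / α = (α + 2 - d) / α + 1 by field_simp; ring,
    Real.Gamma_add_one (div_pos (by linarith) hα0).ne']
  field_simp

section Main

variable {d : ℕ} {ν : Measure (EuclideanSpace ℝ (Fin d))} [IsProbabilityMeasure ν] {ρ : ℝ}

lemma integrable_prod_exp_mul_quadKernel (hd : 1 ≤ d) {α : ℝ} (hα : (d : ℝ) < α)
    (hν : ∀ᵐ z ∂ν, ‖z‖ ≤ ρ) :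
    Integrable (Function.uncurry fun x z : EuclideanSpace ℝ (Fin d) =>
      Real.exp (-‖x‖ ^ (-α)) * quadKernel α x z) (volume.prod ν) := by
  have hα0 : 0 < α := (Nat.cast_nonneg d).trans_lt hα
  have hInt := integrable_norm_rpow_mul_exp hd hα0 one_pos (by linarith : (d : ℝ) < α + 2)
  refine Integrable.mono' (hInt.mul_prod ((integrable_norm_pow hν 2).const_mul (α * (α + 3) / 2)))
    ?_ (ae_of_all _ fun q => ?_)
  · have h := measurable_quadKernel (d := d) α
    exact ((by fun_prop : Measurable fun q : EuclideanSpace ℝ (Fin d) ×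
      EuclideanSpace ℝ (Fin d) => Real.exp (-‖q.1‖ ^ (-α))).mul h).aestronglyMeasurable
  · rw [Function.uncurry, norm_mul, Real.norm_of_nonneg (Real.exp_pos _).le]
    refine (mul_le_mul_of_nonneg_left (abs_quadKernel_le hα0 q.1 q.2)
      (Real.exp_pos _).le).trans_eq ?_
    rw [← norm_rpow_div_norm_sq hα0, div_pow]
    simp only [neg_mul (1 : ℝ), one_mul]
    ring

lemma integral_exp_mul_integral_quadKernel (hd : 1 ≤ d) {α : ℝ} (hα : (d : ℝ) < α)
    (hν : ∀ᵐ z ∂ν, ‖z‖ ≤ ρ) :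
    ∫ x : EuclideanSpace ℝ (Fin d), Real.exp (-‖x‖ ^ (-α)) * ∫ z, quadKernel α x z ∂ν =
      Cda d α * ∫ z, ‖z‖ ^ 2 ∂ν := by
  simp only [← integral_const_mul]
  rw [integral_integral_swap (integrable_prod_exp_mul_quadKernel hd hα hν)]
  simp only [integral_exp_mul_quadKernel hd hα]

lemma ae_measure_singleton_eq_zero (hd : 1 ≤ d) :
    ∀ᵐ x : EuclideanSpace ℝ (Fin d), x ≠ 0 ∧ ν {x} = 0 := by
  have := nontrivial_euclideanSpace_fin hd
  have hcount : {x : EuclideanSpace ℝ (Fin d) | 0 < ν {x}}.Countable :=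
    Measure.countable_meas_pos_of_disjoint_iUnion (fun x => measurableSet_singleton x)
      (fun x y hxy => Set.disjoint_singleton.2 hxy)
  have h1 := hcount.ae_notMem volume
  have h2 := (Set.countable_singleton (0 : EuclideanSpace ℝ (Fin d))).ae_notMem volume
  filter_upwards [h1, h2] with x hx hx0
  exact ⟨hx0, by simpa using hx⟩

lemma measurable_integral_min_norm_sub_rpow (α t : ℝ) :
    Measurable fun x : EuclideanSpace ℝ (Fin d) => ∫ z, min (‖z - x‖ ^ (-α)) t ∂ν := by
  have h : Measurable fun q : EuclideanSpace ℝ (Fin d) × EuclideanSpace ℝ (Fin d) =>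
      min (‖q.2 - q.1‖ ^ (-α)) t := by fun_prop
  exact (h.stronglyMeasurable.integral_prod_right' (ν := ν)).measurable

end Main

/-- Laplace functional asymptotics in rescaled coordinates, for centred measures concentrated
near the origin, with potential truncated at height `t`. -/
lemma exists_rescaled_bound {d : ℕ} (hd : 1 ≤ d) {α : ℝ} (hα : (d : ℝ) < α) :
    ∃ c > 0, ∃ L > 0, ∀ η ρ t : ℝ, 0 < η → η ≤ 1 → 0 ≤ ρ → ρ ≤ c * η → (η / 2) ^ (-α) ≤ t →
      ∀ ν : Measure (EuclideanSpace ℝ (Fin d)), IsProbabilityMeasure ν →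
        (∀ᵐ z ∂ν, ‖z‖ ≤ ρ) → ∫ z, z ∂ν = 0 →
        |(∫ x : EuclideanSpace ℝ (Fin d),
            (1 - Real.exp (-∫ z, min (‖z - x‖ ^ (-α)) t ∂ν))) - a1 d α
            - Cda d α * ∫ z, ‖z‖ ^ 2 ∂ν| ≤
          L * η * (∫ z, ‖z‖ ^ 2 ∂ν) + L * Real.exp (-(2 * η) ^ (-α)) := by
  have hα0 : 0 < α := (Nat.cast_nonneg d).trans_lt hα
  obtain ⟨c₀, hc₀, hc₀', K, hK, hT⟩ := exists_norm_sub_rpow_taylor hα0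
  set M := α * (α + 3) / 2 with hM
  have hM0 : 0 < M := by positivity
  set c := min c₀ (1 / (2 * (M + K) + 1)) with hc
  have hcpos : 0 < c := lt_min hc₀ (by positivity)
  have hc1 : c ≤ 1 / 2 := (min_le_left _ _).trans hc₀'
  have hcK : (M + K) * c ^ 2 ≤ 1 / 2 := by
    have h1 : c * (2 * (M + K) + 1) ≤ 1 := (le_div_iff₀ (by positivity)).1 (min_le_right _ _)
    nlinarith [mul_pos (add_pos hM0 hK) hcpos]
  set N := (M + K) ^ 2 + K + M with hN
  have hN0 : 0 < N := by positivity
  have hH0 : 0 ≤ ∫ x, errorProfile d α x := integral_nonneg (errorProfile_nonneg α)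
  set B := (volume (Metric.closedBall (0 : EuclideanSpace ℝ (Fin d)) 1)).toReal with hB
  have hB0 : 0 ≤ B := ENNReal.toReal_nonneg
  refine ⟨c, hcpos, N * (∫ x, errorProfile d α x) + 2 * B + 1, by positivity,
    fun η ρ t hη hη1 hρ0 hρ ht ν _ hν hm => ?_⟩
  have hV0 : 0 ≤ ∫ z, ‖z‖ ^ 2 ∂ν := integral_nonneg fun z => by positivity
  set V := ∫ z, ‖z‖ ^ 2 ∂ν
  set F : EuclideanSpace ℝ (Fin d) → ℝ := fun x => ∫ z, min (‖z - x‖ ^ (-α)) t ∂ν with hF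
  set Q : EuclideanSpace ℝ (Fin d) → ℝ := fun x => ∫ z, quadKernel α x z ∂ν with hQ
  have hFm : Measurable F := measurable_integral_min_norm_sub_rpow α t
  have iQ : Integrable (fun x => Real.exp (-‖x‖ ^ (-α)) * Q x) := by
    have := (integrable_prod_exp_mul_quadKernel hd hα hν).integral_prod_left
    simpa only [Function.uncurry, integral_const_mul] using this
  have i1 := integrable_one_sub_exp_neg_norm_rpow hd hα
  have iH := (integrable_errorProfile hd hα).const_mul (N * η * V)
  have iB : Integrable ((Metric.closedBall (0 : EuclideanSpace ℝ (Fin d)) 1).indicator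
      fun _ => 2 * Real.exp (-(2 * η) ^ (-α))) :=
    (integrable_indicator_iff Metric.isClosed_closedBall.measurableSet).2
      (integrableOn_const measure_closedBall_lt_top.ne)
  have hbound : ∀ᵐ x : EuclideanSpace ℝ (Fin d),
      ‖Real.exp (-‖x‖ ^ (-α)) - Real.exp (-F x) - Real.exp (-‖x‖ ^ (-α)) * Q x‖ ≤
        N * η * V * errorProfile d α x +
        (Metric.closedBall (0 : EuclideanSpace ℝ (Fin d)) 1).indicator
          (fun _ => 2 * Real.exp (-(2 * η) ^ (-α))) x := by
    filter_upwards [ae_measure_singleton_eq_zero (ν := ν) hd] with x hx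
    rw [Real.norm_eq_abs]
    have hηVH : 0 ≤ η * V * errorProfile d α x :=
      mul_nonneg (mul_nonneg hη.le hV0) (errorProfile_nonneg α x)
    by_cases hxη : ‖x‖ ≤ η
    · have h := near_field_bound hα0 hc1 hη hρ ht hν hxη hx.1 hx.2
      rw [Set.indicator_of_mem (by simpa using hxη.trans hη1)]
      refine h.trans ?_
      change M * η * V * errorProfile d α x + _ ≤ ((M + K) ^ 2 + K + M) * η * V * _ + _
      have : 0 ≤ ((M + K) ^ 2 + K) * (η * V * errorProfile d α x) := by positivity
      linarith
    · have h := far_field_bound hα0 hK hcpos hc1 hcK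
        (fun x z hx hz => hT d x z hx (hz.trans
          (mul_le_mul_of_nonneg_right (min_le_left _ _) (norm_nonneg x))))
        hη hη1 hρ0 hρ ht hν hm (not_le.1 hxη)
      refine h.trans ?_
      have h1 : 0 ≤ (Metric.closedBall (0 : EuclideanSpace ℝ (Fin d)) 1).indicator
          (fun _ => 2 * Real.exp (-(2 * η) ^ (-α))) x :=
        Set.indicator_nonneg (fun _ _ => by positivity) x
      change ((M + K) ^ 2 + K) * η * V * errorProfile d α x ≤
        ((M + K) ^ 2 + K + M) * η * V * _ + _
      have : 0 ≤ M * (η * V * errorProfile d α x) := by positivity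
      linarith
  have iE : Integrable fun x : EuclideanSpace ℝ (Fin d) =>
      Real.exp (-‖x‖ ^ (-α)) - Real.exp (-F x) - Real.exp (-‖x‖ ^ (-α)) * Q x := by
    refine Integrable.mono' (iH.add iB) ?_ hbound
    exact ((by fun_prop : Measurable fun x : EuclideanSpace ℝ (Fin d) =>
      Real.exp (-‖x‖ ^ (-α)) - Real.exp (-F x)).aestronglyMeasurable).sub iQ.aestronglyMeasurable
  have hsplit : (∫ x, (1 - Real.exp (-F x))) - a1 d α - Cda d α * V =
      ∫ x : EuclideanSpace ℝ (Fin d),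
        (Real.exp (-‖x‖ ^ (-α)) - Real.exp (-F x) - Real.exp (-‖x‖ ^ (-α)) * Q x) := by
    have e : ∀ x : EuclideanSpace ℝ (Fin d), 1 - Real.exp (-F x) =
        (Real.exp (-‖x‖ ^ (-α)) - Real.exp (-F x) - Real.exp (-‖x‖ ^ (-α)) * Q x) +
        (1 - Real.exp (-‖x‖ ^ (-α))) + Real.exp (-‖x‖ ^ (-α)) * Q x := fun x => by ring
    have iE1 : Integrable fun x : EuclideanSpace ℝ (Fin d) =>
        (Real.exp (-‖x‖ ^ (-α)) - Real.exp (-F x) - Real.exp (-‖x‖ ^ (-α)) * Q x) +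
        (1 - Real.exp (-‖x‖ ^ (-α))) := iE.add i1
    rw [integral_congr_ae (ae_of_all _ e), integral_add iE1 iQ, integral_add iE i1,
      integral_one_sub_exp_neg_norm_rpow hd hα, integral_exp_mul_integral_quadKernel hd hα hν]
    ring
  rw [hsplit, ← Real.norm_eq_abs]
  refine (norm_integral_le_of_norm_le (iH.add iB) hbound).trans ?_
  rw [integral_add' iH iB, integral_const_mul,
    integral_indicator Metric.isClosed_closedBall.measurableSet, setIntegral_const, smul_eq_mul,
    Measure.real, ← hB]
  have hexp := Real.exp_pos (-(2 * η) ^ (-α))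
  generalize (∫ x, errorProfile d α x) = I at hH0
  have h1 : 0 ≤ η * V := mul_nonneg hη.le hV0
  have h2 : 0 ≤ N * I * Real.exp (-(2 * η) ^ (-α)) := by positivity
  have h3 : 0 ≤ 2 * B * (η * V) := by positivity
  linarith

lemma eventually_scale_conditions {α ε c b : ℝ} (hε : 0 < ε) (hεα : ε * α < 1)
    (hc : 0 < c) (hb : 0 < b) :
    ∀ᶠ t : ℝ in Filter.atTop, t ^ (-(ε / 2)) ≤ c ∧ t ^ (-(ε / 2)) ≤ b ∧
      (t ^ (-(ε / 2)) / 2) ^ (-α) ≤ t := by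
  have h1 : Filter.Tendsto (fun t : ℝ => t ^ (-(ε / 2))) Filter.atTop (nhds 0) :=
    tendsto_rpow_neg_atTop (half_pos hε)
  have h2 : Filter.Tendsto (fun t : ℝ => t ^ (1 - ε / 2 * α)) Filter.atTop Filter.atTop :=
    tendsto_rpow_atTop (by nlinarith)
  filter_upwards [h1.eventually_le_const hc, h1.eventually_le_const hb,
    h2.eventually_ge_atTop (2 ^ α), Filter.eventually_gt_atTop 0] with t hc hb h2 ht
  refine ⟨hc, hb, ?_⟩
  have hη : 0 < t ^ (-(ε / 2)) := Real.rpow_pos_of_pos ht _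
  rw [Real.div_rpow hη.le zero_le_two, ← Real.rpow_mul ht.le, Real.rpow_neg zero_le_two,
    div_inv_eq_mul, show -(ε / 2) * -α = 1 - (1 - ε / 2 * α) by ring, Real.rpow_sub ht 1,
    Real.rpow_one, div_mul_eq_mul_div, div_le_iff₀ (Real.rpow_pos_of_pos ht _)]
  exact mul_le_mul_of_nonneg_left h2 ht.le

lemma eventually_rpow_mul_exp_le {α ε p L : ℝ} (hα : 0 < α) (hε : 0 < ε) (hL : 0 < L) :
    ∀ᶠ t : ℝ in Filter.atTop, t ^ p * (L * Real.exp (-(2 * t ^ (-(ε / 2))) ^ (-α))) ≤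
      Real.exp (-t ^ (ε * α / 4)) := by
  have hγ : 0 < ε * α / 4 := by positivity
  have hs : Filter.Tendsto (fun t : ℝ => t ^ (ε * α / 4)) Filter.atTop Filter.atTop :=
    tendsto_rpow_atTop hγ
  have hlim := (tendsto_rpow_mul_exp_neg_mul_atTop_nhds_zero (p / (ε * α / 4)) 1 one_pos).comp hs
  filter_upwards [hlim.eventually_le_const (inv_pos.2 hL), hs.eventually_ge_atTop (2 * 2 ^ α),
    Filter.eventually_gt_atTop 0] with t h1 h2 ht
  simp only [Function.comp_apply, neg_one_mul] at h1
  have hη : 0 < t ^ (-(ε / 2)) := Real.rpow_pos_of_pos ht _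
  have hp : (t ^ (ε * α / 4)) ^ (p / (ε * α / 4)) = t ^ p := by
    rw [← Real.rpow_mul ht.le, mul_div_cancel₀ _ hγ.ne']
  have hsq : (2 * t ^ (-(ε / 2))) ^ (-α) = (t ^ (ε * α / 4)) ^ 2 / 2 ^ α := by
    rw [Real.mul_rpow zero_le_two hη.le, ← Real.rpow_mul ht.le, Real.rpow_neg zero_le_two,
      ← Real.rpow_natCast, ← Real.rpow_mul ht.le, inv_mul_eq_div]
    congr 2
    push_cast
    ring
  rw [hp] at h1
  rw [hsq]
  set s := t ^ (ε * α / 4)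
  have h2α : (0 : ℝ) < 2 ^ α := Real.rpow_pos_of_pos two_pos _
  have hs0 : 0 < s := Real.rpow_pos_of_pos ht _
  have hge : 2 * s ≤ s ^ 2 / 2 ^ α := by
    rw [le_div_iff₀ h2α]; nlinarith
  have hE : Real.exp (-(s ^ 2 / 2 ^ α)) ≤ Real.exp (-s) * Real.exp (-s) := by
    rw [← Real.exp_add]; exact Real.exp_le_exp.2 (by linarith)
  have htp : 0 < t ^ p := Real.rpow_pos_of_pos ht _
  calc t ^ p * (L * Real.exp (-(s ^ 2 / 2 ^ α)))
      ≤ t ^ p * (L * (Real.exp (-s) * Real.exp (-s))) := by gcongr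
    _ = (t ^ p * Real.exp (-s)) * L * Real.exp (-s) := by ring
    _ ≤ L⁻¹ * L * Real.exp (-s) := by gcongr
    _ = Real.exp (-s) := by rw [inv_mul_cancel₀ hL.ne', one_mul]

/-- Centring a measure at its barycentre and rescaling space by `t^{1/α}`. -/
lemma rescale_measure {d : ℕ} {α ε t : ℝ} (hα : 0 < α) (ht : 0 < t)
    {μ : Measure (EuclideanSpace ℝ (Fin d))} [IsProbabilityMeasure μ]
    (hR : ∀ᵐ z ∂μ, ‖z‖ ≤ t ^ (1 / α - ε)) :
    (∀ᵐ z ∂(μ.map fun z => (t ^ (1 / α))⁻¹ • (z - ∫ w, w ∂μ)), ‖z‖ ≤ 2 * t ^ (-ε)) ∧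
    ∫ z, z ∂(μ.map fun z => (t ^ (1 / α))⁻¹ • (z - ∫ w, w ∂μ)) = 0 ∧
    ∫ z, ‖z‖ ^ 2 ∂(μ.map fun z => (t ^ (1 / α))⁻¹ • (z - ∫ w, w ∂μ)) =
      t ^ (-2 / α) * ∫ z, ‖z - ∫ w, w ∂μ‖ ^ 2 ∂μ ∧
    ∫ y, (1 - Real.exp (-t * ∫ z, vhat d α (z - y) ∂μ)) =
      t ^ ((d : ℝ) / α) * ∫ x, (1 - Real.exp (-∫ z, min (‖z - x‖ ^ (-α)) t
        ∂(μ.map fun z => (t ^ (1 / α))⁻¹ • (z - ∫ w, w ∂μ)))) := by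
  set m := ∫ w, w ∂μ with hm
  set s := t ^ (1 / α) with hs
  have hs0 : 0 < s := Real.rpow_pos_of_pos ht _
  have hφ : Measurable fun z : EuclideanSpace ℝ (Fin d) => s⁻¹ • (z - m) := by fun_prop
  have hid : Integrable (fun z : EuclideanSpace ℝ (Fin d) => z) μ :=
    integrable_id_of_ae_norm_le hR
  have hmR : ‖m‖ ≤ t ^ (1 / α - ε) := by
    simpa using norm_integral_le_of_norm_le_const hR
  refine ⟨?_, ?_, ?_, ?_⟩
  · rw [ae_map_iff hφ.aemeasurable (measurableSet_le measurable_norm measurable_const)]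
    filter_upwards [hR] with z hz
    rw [norm_smul, norm_inv, Real.norm_of_nonneg hs0.le, inv_mul_le_iff₀ hs0]
    have hsε : s * (2 * t ^ (-ε)) = 2 * t ^ (1 / α - ε) := by
      rw [mul_left_comm, hs, ← Real.rpow_add ht, ← sub_eq_add_neg]
    rw [hsε]
    linarith [norm_sub_le z m]
  · rw [integral_map hφ.aemeasurable (by fun_prop), integral_smul,
      integral_sub hid (integrable_const m)]
    simp [hm]
  · rw [integral_map hφ.aemeasurable (by fun_prop), ← integral_const_mul]
    refine integral_congr_ae (ae_of_all _ fun z => ?_)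
    simp only [norm_smul, norm_inv, Real.norm_of_nonneg hs0.le, mul_pow]
    congr 1
    rw [hs, ← Real.rpow_neg ht.le, ← Real.rpow_natCast, ← Real.rpow_mul ht.le]
    congr 1
    push_cast
    ring
  · have hpt : ∀ x z : EuclideanSpace ℝ (Fin d),
        t * vhat d α (z - (m + s • x)) = min (‖s⁻¹ • (z - m) - x‖ ^ (-α)) t := by
      intro x z
      have h1 : z - (m + s • x) = s • (s⁻¹ • (z - m) - x) := by
        rw [smul_sub, smul_inv_smul₀ hs0.ne']
        abel
      have h2 : s ^ (-α) = t⁻¹ := by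
        rw [hs, ← Real.rpow_mul ht.le, ← Real.rpow_neg_one]
        congr 1
        field_simp
      rw [vhat, h1, norm_smul, Real.norm_of_nonneg hs0.le,
        Real.mul_rpow hs0.le (norm_nonneg _), h2, mul_min_of_nonneg _ _ ht.le,
        mul_inv_cancel_left₀ ht.ne', mul_one]
    have hsd : s ^ d = t ^ ((d : ℝ) / α) := by
      rw [hs, ← Real.rpow_natCast, ← Real.rpow_mul ht.le]
      congr 1
      ring
    have hshift := integral_add_left_eq_self (μ := volume)
      (fun y : EuclideanSpace ℝ (Fin d) => 1 - Real.exp (-t * ∫ z, vhat d α (z - y) ∂μ)) m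
    have hscale := Measure.integral_comp_smul volume
      (fun y : EuclideanSpace ℝ (Fin d) =>
        1 - Real.exp (-t * ∫ z, vhat d α (z - (m + y)) ∂μ)) s
    rw [hshift, finrank_euclideanSpace, Fintype.card_fin, smul_eq_mul,
      abs_of_pos (inv_pos.2 (pow_pos hs0 d)), eq_inv_mul_iff_mul_eq₀ (pow_pos hs0 d).ne'] at hscale
    rw [← hscale, hsd]
    congr 1
    refine integral_congr_ae (ae_of_all _ fun x => ?_)
    simp only
    have hmeas : Measurable fun z : EuclideanSpace ℝ (Fin d) => min (‖z - x‖ ^ (-α)) t := by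
      fun_prop
    rw [integral_map hφ.aemeasurable hmeas.aestronglyMeasurable, neg_mul, ← integral_const_mul]
    simp only [hpt]

/-- deterministic Laplace-functional asymptotics
`∫ (1 − e^{−t⟨μ, v̂(·−y)⟩}) dy = a₁ t^{d/α} + (C(d,α)+o(1)) t^{(d−2)/α} ∫|z−m_μ|²μ(dz)`
uniformly over probability measures `μ` supported in the ball of radius
`t^{1/α−ε}`, up to an error `exp(−t^γ)`. -/
theorem stmt_6 (d : ℕ) (hd : 1 ≤ d) (α : ℝ) (hα₁ : (d : ℝ) < α)
    (hα₂ : α < d + 2) (ε : ℝ) (hε : ε ∈ Set.Ioo 0 (1 / α)) :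
    ∃ γ : ℝ, 0 < γ ∧ ∀ δ : ℝ, 0 < δ → ∃ T : ℝ, 0 < T ∧ ∀ t : ℝ, T ≤ t →
      ∀ μ : Measure (EuclideanSpace ℝ (Fin d)), IsProbabilityMeasure μ →
        μ (Metric.closedBall (0 : EuclideanSpace ℝ (Fin d)) (t ^ (1 / α - ε)))ᶜ = 0 →
        |(∫ y : EuclideanSpace ℝ (Fin d),
              (1 - Real.exp (-t * ∫ z, vhat d α (z - y) ∂μ)))
            - a1 d α * t ^ ((d : ℝ) / α)
            - Cda d α * t ^ (((d : ℝ) - 2) / α)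
                * (∫ z, ‖z - (∫ w, w ∂μ)‖ ^ 2 ∂μ)|
          ≤ δ * t ^ (((d : ℝ) - 2) / α) * (∫ z, ‖z - (∫ w, w ∂μ)‖ ^ 2 ∂μ)
            + Real.exp (-t ^ γ) := by
  obtain ⟨hε0, hε1⟩ := hε
  have hα0 : 0 < α := (Nat.cast_nonneg d).trans_lt hα₁
  have hεα : ε * α < 1 := (lt_div_iff₀ hα0).1 hε1
  obtain ⟨c, hc, L, hL, hcore⟩ := exists_rescaled_bound hd hα₁
  refine ⟨ε * α / 4, by positivity, fun δ hδ => ?_⟩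
  obtain ⟨T, hT⟩ := Filter.eventually_atTop.1 (((eventually_scale_conditions hε0 hεα
    (half_pos hc) (div_pos hδ hL)).and
    (eventually_rpow_mul_exp_le (p := (d : ℝ) / α) hα0 hε0 hL)).and (Filter.eventually_ge_atTop 1))
  refine ⟨max T 1, by positivity, fun t ht μ hμ hsupp => ?_⟩
  obtain ⟨⟨⟨hs1, hs2, hs3⟩, hexp⟩, ht1⟩ := hT t ((le_max_left _ _).trans ht)
  have ht0 : 0 < t := one_pos.trans_le ht1
  have hR : ∀ᵐ z ∂μ, ‖z‖ ≤ t ^ (1 / α - ε) := by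
    rw [ae_iff]
    refine measure_mono_null (fun z hz => ?_) hsupp
    simpa using hz
  obtain ⟨hν, hm, hV, hInt⟩ := rescale_measure hα0 ht0 hR
  set ν := μ.map fun z => (t ^ (1 / α))⁻¹ • (z - ∫ w, w ∂μ) with hνdef
  have hνp : IsProbabilityMeasure ν := Measure.isProbabilityMeasure_map (by fun_prop)
  have hsplit : t ^ (-ε) = t ^ (-(ε / 2)) * t ^ (-(ε / 2)) := by
    rw [← Real.rpow_add ht0]; congr 1; ring
  have hη0 : 0 < t ^ (-(ε / 2)) := Real.rpow_pos_of_pos ht0 _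
  have hη1 : t ^ (-(ε / 2)) ≤ 1 := Real.rpow_le_one_of_one_le_of_nonpos ht1 (by linarith)
  have hρ : 2 * t ^ (-ε) ≤ c * t ^ (-(ε / 2)) := by
    rw [hsplit]; nlinarith
  have hmain := hcore _ _ t hη0 hη1 (by positivity) hρ hs3 ν hνp hν hm
  rw [hInt, hV] at *
  set W := ∫ z, ‖z - ∫ w, w ∂μ‖ ^ 2 ∂μ
  have hW0 : 0 ≤ W := integral_nonneg fun z => by positivity
  set I := ∫ x : EuclideanSpace ℝ (Fin d), (1 - Real.exp (-∫ z, min (‖z - x‖ ^ (-α)) t ∂ν))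
  have hpow : t ^ (((d : ℝ) - 2) / α) = t ^ ((d : ℝ) / α) * t ^ (-2 / α) := by
    rw [← Real.rpow_add ht0]; congr 1; ring
  have htd : 0 < t ^ ((d : ℝ) / α) := Real.rpow_pos_of_pos ht0 _
  have ht2 : 0 < t ^ (-2 / α) := Real.rpow_pos_of_pos ht0 _
  rw [hpow, show t ^ ((d : ℝ) / α) * I - a1 d α * t ^ ((d : ℝ) / α) -
      Cda d α * (t ^ ((d : ℝ) / α) * t ^ (-2 / α)) * W =
      t ^ ((d : ℝ) / α) * (I - a1 d α - Cda d α * (t ^ (-2 / α) * W)) by ring, abs_mul,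
    abs_of_pos htd]
  refine (mul_le_mul_of_nonneg_left hmain htd.le).trans ?_
  have hLδ : L * t ^ (-(ε / 2)) ≤ δ := by
    rw [le_div_iff₀ hL] at hs2; linarith
  have := mul_le_mul_of_nonneg_right hLδ
    (by positivity : 0 ≤ t ^ ((d : ℝ) / α) * (t ^ (-2 / α) * W))
  linarith
end

section
/- Let M > 0. There exists γ > 0 such that for every δ > 0 there is T > 0 with the following property: for all t ≥ T and every Borel probability measure μ on ℝ^d with support contained in the closed ball of radius t^{(α−d+2)/(4α)} log t centered at the origin and with ∫ |x − m_μ|² μ(dx) ≤ M t^{(α−d+2)/(2α)}, | ∫_{ℝ^d} v̂(m_μ − y) exp( −t ∫ v̂(z−y) μ(dz) ) dy − a₁ (d/α) t^{−(α−d)/α} + ((α−d+2)/α) C(d,α) t^{−(α−d+2)/α} ∫ |x − m_μ|² μ(dx) | ≤ δ t^{−(α−d+2)/α} ∫ |x − m_μ|² μ(dx) + exp(−t^γ). (Deterministic form of the weighted mean of the potential at the barycenter, E_t^μ[V_ω(m_μ)] = a₁(d/α) t^{−(α−d)/α} − ((α−d+2)/α)(C(d,α)+o(1)) t^{−(α−d+2)/α}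 ∫|x−m_μ|² μ(dx), used in the proof that Q_t[V_ω(m_t(ω))] = a₁(d/α) t^{−(α−d)/α} − (√(C(d,α)/8)+o(1)) t^{−(α−d+2)/(2α)}.) -/
open MeasureTheory

/-- A bound `|g'(u)| ≤ K |u|ⁿ` on an interval around `0` integrates to `|g(u)| ≤ K |u|ⁿ⁺¹`. -/
lemma abs_le_mul_abs_pow_succ_of_hasDerivAt {g g' : ℝ → ℝ} {a b K : ℝ} (ha : a ≤ 0) (hb : 0 ≤ b)
    (hK : 0 ≤ K) (n : ℕ) (hg : ∀ u ∈ Set.Icc a b, HasDerivAt g (g' u) u) (hg0 : g 0 = 0)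
    (hg' : ∀ u ∈ Set.Icc a b, |g' u| ≤ K * |u| ^ n) :
    ∀ u ∈ Set.Icc a b, |g u| ≤ K * |u| ^ (n + 1) := by
  intro u hu
  have hsub : Set.uIcc 0 u ⊆ Set.Icc a b := Set.uIcc_subset_Icc ⟨ha, hb⟩ hu
  have h := Convex.norm_image_sub_le_of_norm_hasDerivWithin_le (f := g) (f' := g')
    (s := Set.uIcc 0 u) (x := 0) (y := u) (C := K * |u| ^ n)
    (fun x hx => (hg x (hsub hx)).hasDerivWithinAt)
    (fun x hx => by
      rw [Real.norm_eq_abs]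
      refine (hg' x (hsub hx)).trans ?_
      have : |x| ≤ |u| := by
        have := Set.abs_sub_left_of_mem_uIcc hx
        simpa using this
      gcongr)
    (convex_uIcc 0 u) Set.left_mem_uIcc Set.right_mem_uIcc
  simpa [hg0, pow_succ, mul_assoc] using h

/-- Second order Taylor expansion of `u ↦ (1 + u)⁻ᵃ` at `0`, with cubic remainder. -/
lemma abs_one_add_rpow_neg_sub_taylor_le {a : ℝ} (ha : 0 < a) {u : ℝ}
    (hu : u ∈ Set.Icc (-3 / 4 : ℝ) (5 / 4)) :
    |(1 + u) ^ (-a) - 1 + a * u - a * (a + 1) / 2 * u ^ 2|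
      ≤ a * (a + 1) * (a + 2) * 4 ^ (a + 3) * |u| ^ 3 := by
  have hder : ∀ b : ℝ, ∀ u ∈ Set.Icc (-3 / 4 : ℝ) (5 / 4),
      HasDerivAt (fun u : ℝ => (1 + u) ^ (-b)) (-b * (1 + u) ^ (-(b + 1))) u := by
    intro b u hu
    have h1 : (1 + u) ≠ 0 := by linarith [hu.1]
    have h := ((hasDerivAt_id u).const_add 1).rpow_const (p := -b) (Or.inl h1)
    refine h.congr_deriv ?_
    rw [id_eq, one_mul, show -b - 1 = -(b + 1) by ring]
  set K := a * (a + 1) * (a + 2) * 4 ^ (a + 3) with hK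
  have hK0 : 0 ≤ K := by positivity
  have hthird : ∀ u ∈ Set.Icc (-3 / 4 : ℝ) (5 / 4),
      |-(a * (a + 1) * (a + 2)) * (1 + u) ^ (-(a + 3))| ≤ K * |u| ^ 0 := by
    intro u hu
    have h1 : (1 / 4 : ℝ) ≤ 1 + u := by linarith [hu.1]
    have h2 : (1 + u) ^ (-(a + 3)) ≤ 4 ^ (a + 3) := by
      calc (1 + u) ^ (-(a + 3)) ≤ (1 / 4 : ℝ) ^ (-(a + 3)) :=
            Real.rpow_le_rpow_of_nonpos (by norm_num) h1 (by linarith)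
        _ = 4 ^ (a + 3) := by
            rw [one_div, Real.inv_rpow (by norm_num), Real.rpow_neg (by norm_num), inv_inv]
    have h3 : 0 ≤ (1 + u) ^ (-(a + 3)) := Real.rpow_nonneg (by linarith) _
    rw [abs_mul, abs_neg, abs_of_nonneg (by positivity), abs_of_nonneg h3, pow_zero, mul_one, hK]
    gcongr
  have hsecond := abs_le_mul_abs_pow_succ_of_hasDerivAt
    (g := fun u => a * (a + 1) * (1 + u) ^ (-(a + 2)) - a * (a + 1))
    (a := -3 / 4) (b := 5 / 4) (by norm_num) (by norm_num) hK0 0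
    (fun u hu => by
      have h := ((hder (a + 2) u hu).const_mul (a * (a + 1))).sub_const (a * (a + 1))
      refine h.congr_deriv ?_
      rw [show a + 2 + 1 = a + 3 by ring]
      ring)
    (by simp) hthird
  have hfirst := abs_le_mul_abs_pow_succ_of_hasDerivAt
    (g := fun u => -a * (1 + u) ^ (-(a + 1)) + a - a * (a + 1) * u)
    (a := -3 / 4) (b := 5 / 4) (by norm_num) (by norm_num) hK0 1
    (fun u hu => by
      have h := ((((hder (a + 1) u hu).const_mul (-a)).add_const a).sub
        ((hasDerivAt_id u).const_mul (a * (a + 1))))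
      refine h.congr_deriv ?_
      rw [show a + 1 + 1 = a + 2 by ring]
      ring)
    (by simp) hsecond
  have hzero := abs_le_mul_abs_pow_succ_of_hasDerivAt
    (g := fun u => (1 + u) ^ (-a) - 1 + a * u - a * (a + 1) / 2 * u ^ 2)
    (a := -3 / 4) (b := 5 / 4) (by norm_num) (by norm_num) hK0 2
    (fun u hu => by
      have h := ((((hder a u hu).sub_const 1).add ((hasDerivAt_id u).const_mul a)).sub
        (((hasDerivAt_id u).pow 2).const_mul (a * (a + 1) / 2)))
      refine h.congr_deriv ?_
      norm_num
      ring)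
    (by simp) hfirst
  exact hzero u hu

section InnerProductSpace

variable {E : Type*} [NormedAddCommGroup E] [InnerProductSpace ℝ E]

/-- Half of the Hessian of `x ↦ ‖x‖⁻ᵅ` at `η`, as a quadratic form in `ζ`. -/
noncomputable def halfHessian (α : ℝ) (η ζ : E) : ℝ :=
  α * (α + 2) / 2 * ‖η‖ ^ (-α - 4) * inner ℝ η ζ ^ 2 - α / 2 * ‖η‖ ^ (-α - 2) * ‖ζ‖ ^ 2

lemma abs_halfHessian_le {α : ℝ} (hα : 0 < α) {η : E} (hη : η ≠ 0) (ζ : E) :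
    |halfHessian α η ζ| ≤ α * (α + 3) * ‖η‖ ^ (-α - 2) * ‖ζ‖ ^ 2 := by
  have hη0 : 0 < ‖η‖ := norm_pos_iff.2 hη
  have h1 : inner ℝ η ζ ^ 2 ≤ ‖η‖ ^ 2 * ‖ζ‖ ^ 2 := by
    rw [← mul_pow, ← sq_abs]
    gcongr
    exact abs_real_inner_le_norm η ζ
  have h2 : ‖η‖ ^ (-α - 4) * ‖η‖ ^ 2 = ‖η‖ ^ (-α - 2) := by
    rw [← Real.rpow_natCast, ← Real.rpow_add hη0]
    norm_num
    ring_nf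
  have h3 : α * (α + 2) / 2 * ‖η‖ ^ (-α - 4) * inner ℝ η ζ ^ 2
      ≤ α * (α + 2) / 2 * (‖η‖ ^ (-α - 2) * ‖ζ‖ ^ 2) := by
    rw [← h2]
    calc α * (α + 2) / 2 * ‖η‖ ^ (-α - 4) * inner ℝ η ζ ^ 2
        ≤ α * (α + 2) / 2 * ‖η‖ ^ (-α - 4) * (‖η‖ ^ 2 * ‖ζ‖ ^ 2) := by gcongr
      _ = _ := by ring
  have h4 : 0 ≤ α * (α + 2) / 2 * ‖η‖ ^ (-α - 4) * inner ℝ η ζ ^ 2 := by positivity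
  have h5 : 0 ≤ ‖η‖ ^ (-α - 2) * ‖ζ‖ ^ 2 := by positivity
  rw [halfHessian, abs_le]
  constructor <;> nlinarith [mul_nonneg hα.le h5, mul_nonneg (mul_nonneg hα.le hα.le) h5]

/-- Second order Taylor expansion of `x ↦ ‖x‖⁻ᵅ`, with cubic remainder. -/
lemma exists_norm_sub_rpow_taylor_bound {α : ℝ} (hα : 0 < α) :
    ∃ K : ℝ, 0 ≤ K ∧ ∀ η ζ : E, η ≠ 0 → 2 * ‖ζ‖ ≤ ‖η‖ →
      |‖ζ - η‖ ^ (-α) - ‖η‖ ^ (-α) - α * ‖η‖ ^ (-α - 2) * inner ℝ η ζ - halfHessian α η ζ|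
        ≤ K * ‖η‖ ^ (-α - 3) * ‖ζ‖ ^ 3 := by
  set K₀ := α / 2 * (α / 2 + 1) * (α / 2 + 2) * 4 ^ (α / 2 + 3) with hK₀
  have hK₀0 : 0 ≤ K₀ := by positivity
  refine ⟨K₀ * (5 / 2) ^ 3 + α / 2 * (α / 2 + 1) / 2 * 5, by positivity, fun η ζ hη hζ => ?_⟩
  have hη0 : 0 < ‖η‖ := norm_pos_iff.2 hη
  set s := ‖ζ‖ / ‖η‖ with hs
  set p := inner ℝ η ζ / ‖η‖ ^ 2 with hp
  have hs0 : 0 ≤ s := by positivity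
  have hs1 : s ≤ 1 / 2 := by rw [hs, div_le_iff₀ hη0]; linarith
  have hps : |p| ≤ s := by
    rw [hp, hs, abs_div, abs_of_nonneg (by positivity : (0:ℝ) ≤ ‖η‖ ^ 2),
      div_le_div_iff₀ (by positivity) hη0]
    nlinarith [abs_real_inner_le_norm η ζ]
  have hζs : ‖ζ‖ = s * ‖η‖ := by rw [hs]; field_simp
  have hip : inner ℝ η ζ = p * ‖η‖ ^ 2 := by rw [hp]; field_simp
  set u := s ^ 2 - 2 * p with hu
  have hp' := abs_le.1 hps
  have hnorm : ‖ζ - η‖ ^ 2 = ‖η‖ ^ 2 * (1 + u) := by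
    rw [norm_sub_sq_real, real_inner_comm, hip, hζs, hu]; ring
  have hnorm' : ‖ζ - η‖ / ‖η‖ ≥ 1 / 2 := by
    rw [ge_iff_le, le_div_iff₀ hη0]
    have := norm_sub_norm_le η ζ
    rw [norm_sub_rev] at this
    linarith
  have hu1 : 1 / 4 ≤ 1 + u := by
    have h : 1 + u = (‖ζ - η‖ / ‖η‖) ^ 2 := by rw [div_pow, hnorm]; field_simp
    rw [h]; nlinarith
  have hu2 : |u| ≤ 5 / 2 * s := by
    rw [hu, abs_le]; constructor <;> nlinarith
  have huI : u ∈ Set.Icc (-3 / 4 : ℝ) (5 / 4) :=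
    ⟨by linarith, by linarith [(abs_le.1 hu2).2]⟩
  have hpow : ‖ζ - η‖ ^ (-α) = ‖η‖ ^ (-α) * (1 + u) ^ (-(α / 2)) := by
    have h : ∀ x : ℝ, 0 ≤ x → x ^ (-α) = (x ^ 2) ^ (-(α / 2)) := fun x hx => by
      rw [← Real.rpow_natCast, ← Real.rpow_mul hx]; norm_num; ring_nf
    rw [h _ (norm_nonneg _), h _ hη0.le, hnorm, Real.mul_rpow (by positivity) (by linarith)]
  have hT := abs_one_add_rpow_neg_sub_taylor_le (half_pos hα) huI
  rw [← hK₀] at hT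
  have hquad : |u ^ 2 - 4 * p ^ 2| ≤ 5 * s ^ 3 := by
    have h : u ^ 2 - 4 * p ^ 2 = s ^ 3 * s - 4 * (s ^ 2 * p) := by rw [hu]; ring
    have h3 : 0 ≤ s ^ 3 := by positivity
    have h4 : |s ^ 2 * p| ≤ s ^ 3 := by
      rw [abs_mul, abs_of_nonneg (sq_nonneg s)]; nlinarith [sq_nonneg s]
    have h4' := abs_le.1 h4
    rw [h, abs_le]; constructor <;> nlinarith
  have e1 : ‖η‖ ^ (-α - 2) * ‖η‖ ^ 2 = ‖η‖ ^ (-α) := by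
    rw [← Real.rpow_natCast, ← Real.rpow_add hη0]; norm_num
  have e2 : ‖η‖ ^ (-α - 4) * ‖η‖ ^ 4 = ‖η‖ ^ (-α) := by
    rw [← Real.rpow_natCast, ← Real.rpow_add hη0]; norm_num
  have e3 : ‖η‖ ^ (-α - 3) * ‖η‖ ^ 3 = ‖η‖ ^ (-α) := by
    rw [← Real.rpow_natCast, ← Real.rpow_add hη0]; norm_num
  have hlhs : ‖ζ - η‖ ^ (-α) - ‖η‖ ^ (-α) - α * ‖η‖ ^ (-α - 2) * inner ℝ η ζ - halfHessian α η ζ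
      = ‖η‖ ^ (-α) * (((1 + u) ^ (-(α / 2)) - 1 + α / 2 * u - α / 2 * (α / 2 + 1) / 2 * u ^ 2)
        + α / 2 * (α / 2 + 1) / 2 * (u ^ 2 - 4 * p ^ 2)) := by
    have a1 : α * ‖η‖ ^ (-α - 2) * inner ℝ η ζ = α * p * ‖η‖ ^ (-α) := by
      rw [hip, ← e1]; ring
    have a2 : halfHessian α η ζ
        = α * (α + 2) / 2 * ‖η‖ ^ (-α) * p ^ 2 - α / 2 * ‖η‖ ^ (-α) * s ^ 2 := by
      rw [halfHessian, hip, hζs]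
      linear_combination α * (α + 2) / 2 * p ^ 2 * e2 - α / 2 * s ^ 2 * e1
    rw [a1, a2, hpow, hu]; ring
  have hrhs : ‖η‖ ^ (-α - 3) * ‖ζ‖ ^ 3 = ‖η‖ ^ (-α) * s ^ 3 := by rw [hζs, ← e3]; ring
  have hu3 : |u| ^ 3 ≤ (5 / 2) ^ 3 * s ^ 3 := by rw [← mul_pow]; gcongr
  rw [hlhs, abs_mul, abs_of_nonneg (by positivity : 0 ≤ ‖η‖ ^ (-α)), mul_assoc, hrhs]
  calc _ ≤ ‖η‖ ^ (-α) * (K₀ * ((5 / 2) ^ 3 * s ^ 3) + α / 2 * (α / 2 + 1) / 2 * (5 * s ^ 3)) := by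
        gcongr
        refine (abs_add_le _ _).trans (add_le_add (hT.trans (by gcongr)) ?_)
        rw [abs_mul, abs_of_nonneg (by positivity : 0 ≤ α / 2 * (α / 2 + 1) / 2)]
        gcongr
    _ = _ := by ring

end InnerProductSpace

lemma pow_finrank_sub_one_mul_radial_eq {α c p y : ℝ} (hα : 0 < α) {n : ℕ} (hn : 0 < n)
    (hy : 0 < y) :
    y ^ (n - 1) • (y ^ (-p) * Real.exp (-(c * y ^ (-α))))
      = (|(-α)| * y ^ (-α - 1)) • (1 / α *
        ((y ^ (-α)) ^ ((p - n) / α - 1) * Real.exp (-(c * y ^ (-α))))) := by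
  have h1 : (y ^ (-α)) ^ ((p - n) / α - 1) = y ^ (n - p + α) := by
    rw [← Real.rpow_mul hy.le]
    congr 1
    field_simp
    ring
  have h2 : y ^ (n - 1) = y ^ ((n : ℝ) - 1) := by
    rw [← Real.rpow_natCast, Nat.cast_sub hn, Nat.cast_one]
  have h3 : y ^ ((n : ℝ) - 1) * y ^ (-p) = y ^ (-α - 1) * y ^ (n - p + α) := by
    rw [← Real.rpow_add hy, ← Real.rpow_add hy]
    congr 1
    ring
  rw [h1, h2, abs_neg, abs_of_pos hα, smul_eq_mul, smul_eq_mul, ← mul_assoc, h3]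
  field_simp

lemma integrableOn_rpow_sub_one_mul_exp_neg_mul {c s : ℝ} (hc : 0 < c) (hs : 0 < s) :
    IntegrableOn (fun x : ℝ => x ^ (s - 1) * Real.exp (-(c * x))) (Set.Ioi 0) := by
  have h := integrableOn_rpow_mul_exp_neg_mul_rpow (p := 1) (s := s - 1) (b := c)
    (by linarith) one_pos hc
  simpa using h

section Radial

variable {E : Type*} [NormedAddCommGroup E] [InnerProductSpace ℝ E] [FiniteDimensional ℝ E]
  [MeasurableSpace E] [BorelSpace E]

lemma integrable_radial_mul_inner_sq (φ : ℝ → ℝ)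
    (hφ : Integrable (fun η : E => φ ‖η‖ * ‖η‖ ^ 2)) (hφm : Measurable φ) (x : E) :
    Integrable (fun η : E => φ ‖η‖ * inner ℝ η x ^ 2) := by
  refine (hφ.norm.mul_const (‖x‖ ^ 2)).mono' (by fun_prop)
    (Filter.Eventually.of_forall fun η => ?_)
  rw [norm_mul, norm_mul, mul_assoc]
  gcongr
  rw [norm_pow, norm_pow, norm_norm, ← mul_pow]
  gcongr
  exact norm_inner_le_norm η x

variable [Nontrivial E]

/-- Integrability of `‖η‖⁻ᵖ exp (-c ‖η‖⁻ᵅ)` for `p` larger than the dimension. -/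
lemma integrable_norm_rpow_neg_mul_exp {α c p : ℝ} (hα : 0 < α) (hc : 0 < c)
    (hp : (Module.finrank ℝ E : ℝ) < p) :
    Integrable (fun η : E => ‖η‖ ^ (-p) * Real.exp (-(c * ‖η‖ ^ (-α)))) := by
  refine (integrable_fun_norm_addHaar (volume : Measure E)
    (f := fun r : ℝ => r ^ (-p) * Real.exp (-(c * r ^ (-α))))).2 ?_
  refine (integrableOn_congr_fun (fun y (hy : 0 < y) =>
    pow_finrank_sub_one_mul_radial_eq hα Module.finrank_pos hy) measurableSet_Ioi).2 ?_
  refine (integrableOn_Ioi_comp_rpow_iff (fun x : ℝ => 1 / α *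
    (x ^ ((p - Module.finrank ℝ E) / α - 1) * Real.exp (-(c * x)))) (neg_ne_zero.2 hα.ne')).2 ?_
  exact (integrableOn_rpow_sub_one_mul_exp_neg_mul hc (div_pos (sub_pos.2 hp) hα)).const_mul _

lemma integral_norm_rpow_neg_mul_exp {α p : ℝ} (hα : 0 < α)
    (hp : (Module.finrank ℝ E : ℝ) < p) :
    ∫ η : E, ‖η‖ ^ (-p) * Real.exp (-‖η‖ ^ (-α))
      = Module.finrank ℝ E * volume.real (Metric.ball (0 : E) 1) / α
        * Real.Gamma ((p - Module.finrank ℝ E) / α) := by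
  have h := integral_fun_norm_addHaar (volume : Measure E)
    (fun r : ℝ => r ^ (-p) * Real.exp (-(1 * r ^ (-α))))
  rw [setIntegral_congr_fun measurableSet_Ioi
    (fun y hy => pow_finrank_sub_one_mul_radial_eq hα Module.finrank_pos hy),
    integral_comp_rpow_Ioi (fun x : ℝ => 1 / α *
    (x ^ ((p - Module.finrank ℝ E) / α - 1) * Real.exp (-(1 * x)))) (neg_ne_zero.2 hα.ne'),
    integral_const_mul,
    Real.integral_rpow_mul_exp_neg_mul_Ioi (div_pos (sub_pos.2 hp) hα) one_pos] at h
  simp only [one_mul, nsmul_eq_mul, smul_eq_mul, div_one, Real.one_rpow] at h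
  rw [h]
  ring

/-- Rotation invariance: the quadratic form `ζ ↦ ∫ φ(‖η‖) ⟪η, ζ⟫²` is a multiple of `‖ζ‖²`. -/
lemma integral_radial_mul_inner_sq_s10 (φ : ℝ → ℝ)
    (hφ : Integrable (fun η : E => φ ‖η‖ * ‖η‖ ^ 2)) (hφm : Measurable φ) (ζ : E) :
    ∫ η : E, φ ‖η‖ * inner ℝ η ζ ^ 2
      = ‖ζ‖ ^ 2 / Module.finrank ℝ E * ∫ η : E, φ ‖η‖ * ‖η‖ ^ 2 := by
  have hrot : ∀ x y : E, ‖x‖ = ‖y‖ →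
      ∫ η : E, φ ‖η‖ * inner ℝ η x ^ 2 = ∫ η : E, φ ‖η‖ * inner ℝ η y ^ 2 := by
    intro x y hxy
    set U := (Submodule.span ℝ {x - y})ᗮ.reflection
    have hU : U x = y := Submodule.reflection_sub hxy
    rw [← (LinearIsometryEquiv.measurePreserving U).integral_comp
      U.toHomeomorph.measurableEmbedding (fun η => φ ‖η‖ * inner ℝ η y ^ 2)]
    refine integral_congr_ae (Filter.Eventually.of_forall fun η => ?_)
    simp only [LinearIsometryEquiv.norm_map]
    rw [← hU, LinearIsometryEquiv.inner_map_map]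
  have hint := integrable_radial_mul_inner_sq φ hφ hφm
  set b := stdOrthonormalBasis ℝ E
  have hb : ∀ i, ∫ η : E, φ ‖η‖ * inner ℝ η ζ ^ 2
      = ‖ζ‖ ^ 2 * ∫ η : E, φ ‖η‖ * inner ℝ (b i) η ^ 2 := by
    intro i
    rw [hrot ζ (‖ζ‖ • b i) (by rw [norm_smul, b.norm_eq_one]; simp), ← integral_const_mul]
    refine integral_congr_ae (Filter.Eventually.of_forall fun η => ?_)
    simp only [inner_smul_right]
    rw [real_inner_comm]
    ring
  have hsum : ∑ i, ∫ η : E, φ ‖η‖ * inner ℝ (b i) η ^ 2 = ∫ η : E, φ ‖η‖ * ‖η‖ ^ 2 := by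
    rw [← integral_finsetSum _ fun i _ => by simpa only [real_inner_comm] using hint (b i)]
    refine integral_congr_ae (Filter.Eventually.of_forall fun η => ?_)
    simp only
    rw [← Finset.mul_sum, b.sum_sq_inner_right]
  have hn : (Module.finrank ℝ E : ℝ) ≠ 0 := by
    exact_mod_cast (Module.finrank_pos (R := ℝ) (M := E)).ne'
  have htot : (Module.finrank ℝ E : ℝ) * ∫ η : E, φ ‖η‖ * inner ℝ η ζ ^ 2
      = ‖ζ‖ ^ 2 * ∫ η : E, φ ‖η‖ * ‖η‖ ^ 2 := by
    rw [← hsum, Finset.mul_sum, ← Finset.sum_congr rfl fun i _ => hb i]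
    simp
  field_simp
  linarith

end Radial

/-- First order expansion of the exponential with quadratic remainder. -/
lemma abs_exp_neg_sub_add_le {f h m : ℝ} (hf : m ≤ f) (hh : m ≤ h) :
    |Real.exp (-f) - Real.exp (-h) + Real.exp (-h) * (f - h)| ≤ (f - h) ^ 2 * Real.exp (-m) := by
  set D := f - h with hD
  have hnonneg : 0 ≤ Real.exp (-f) - Real.exp (-h) + Real.exp (-h) * D := by
    have h1 : Real.exp (-f) = Real.exp (-h) * Real.exp (-D) := by
      rw [← Real.exp_add, hD]; ring_nf
    have h2 := Real.add_one_le_exp (-D)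
    rw [h1]
    nlinarith [Real.exp_pos (-h)]
  rw [abs_of_nonneg hnonneg]
  rcases le_total 0 D with h0 | h0
  · have h1 : Real.exp (-f) = Real.exp (-h) * Real.exp (-D) := by
      rw [← Real.exp_add, hD]; ring_nf
    have h2 : Real.exp (-D) * (1 + D) ≤ 1 := by
      have := Real.add_one_le_exp D
      calc Real.exp (-D) * (1 + D) ≤ Real.exp (-D) * Real.exp D := by gcongr; linarith
        _ = 1 := by rw [← Real.exp_add]; simp
    have h3 : Real.exp (-D) - 1 + D ≤ D ^ 2 := by
      nlinarith [Real.exp_pos (-D)]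
    have h4 : Real.exp (-h) ≤ Real.exp (-m) := Real.exp_le_exp.2 (by linarith)
    calc Real.exp (-f) - Real.exp (-h) + Real.exp (-h) * D
        = Real.exp (-h) * (Real.exp (-D) - 1 + D) := by rw [h1]; ring
      _ ≤ Real.exp (-m) * D ^ 2 := by
          refine (mul_le_mul_of_nonneg_left h3 (Real.exp_pos _).le).trans ?_
          gcongr
      _ = _ := by ring
  · have h1 : Real.exp (-h) = Real.exp (-f) * Real.exp D := by
      rw [← Real.exp_add, hD]; ring_nf
    have h2 := Real.add_one_le_exp D
    have h3 : 1 - Real.exp D * (1 - D) ≤ D ^ 2 := by nlinarith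
    have h4 : Real.exp (-f) ≤ Real.exp (-m) := Real.exp_le_exp.2 (by linarith)
    calc Real.exp (-f) - Real.exp (-h) + Real.exp (-h) * D
        = Real.exp (-f) * (1 - Real.exp D * (1 - D)) := by rw [h1]; ring
      _ ≤ Real.exp (-m) * D ^ 2 := by
          refine (mul_le_mul_of_nonneg_left h3 (Real.exp_pos _).le).trans ?_
          gcongr
      _ = _ := by ring

lemma norm_bounds_of_two_mul_le {E : Type*} [NormedAddCommGroup E] {ε : ℝ} {η ζ : E}
    (hη : 2 * ε ≤ ‖η‖) (hζ : ‖ζ‖ ≤ ε) :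
    ε ≤ ‖ζ - η‖ ∧ ‖ζ - η‖ ≤ 3 / 2 * ‖η‖ := by
  have h1 := norm_sub_norm_le η ζ
  have h2 := norm_sub_le ζ η
  rw [norm_sub_rev] at h1
  constructor <;> linarith

lemma integrable_norm_sub_rpow_neg {E : Type*} [NormedAddCommGroup E] [MeasurableSpace E]
    [BorelSpace E] {ν : Measure E} [IsProbabilityMeasure ν] {ε α : ℝ} (hα : 0 < α) (hε : 0 < ε)
    (hν : ∀ᵐ ζ ∂ν, ‖ζ‖ ≤ ε) {η : E} (hη : 2 * ε ≤ ‖η‖) :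
    Integrable (fun ζ => ‖ζ - η‖ ^ (-α)) ν := by
  have hmeas : Measurable fun ζ : E => ‖ζ - η‖ ^ (-α) := by fun_prop
  refine Integrable.of_bound hmeas.aestronglyMeasurable (ε ^ (-α)) ?_
  filter_upwards [hν] with ζ hζ
  rw [Real.norm_of_nonneg (by positivity)]
  exact Real.rpow_le_rpow_of_nonpos hε (norm_bounds_of_two_mul_le hη hζ).1 (by linarith)

section Centered

variable {E : Type*} [NormedAddCommGroup E] [InnerProductSpace ℝ E] [FiniteDimensional ℝ E]
  [MeasurableSpace E] [BorelSpace E]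

lemma measurable_halfHessian_right (α : ℝ) (η : E) : Measurable (halfHessian α η) := by
  unfold halfHessian
  fun_prop

lemma integrable_norm_pow_of_ae_norm_le {ν : Measure E} [IsProbabilityMeasure ν] {ε : ℝ}
    (hν : ∀ᵐ ζ ∂ν, ‖ζ‖ ≤ ε) (n : ℕ) : Integrable (fun ζ : E => ‖ζ‖ ^ n) ν := by
  refine Integrable.of_bound (by fun_prop) (ε ^ n) ?_
  filter_upwards [hν] with ζ hζ
  rw [norm_pow, norm_norm]
  gcongr

lemma integrable_id_of_ae_norm_le_s10 {ν : Measure E} [IsProbabilityMeasure ν] {ε : ℝ}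
    (hν : ∀ᵐ ζ ∂ν, ‖ζ‖ ≤ ε) : Integrable (fun ζ : E => ζ) ν :=
  Integrable.of_bound (by fun_prop) ε hν

lemma integral_norm_sq_le_s10 {ν : Measure E} [IsProbabilityMeasure ν] {ε : ℝ}
    (hν : ∀ᵐ ζ ∂ν, ‖ζ‖ ≤ ε) : ∫ ζ, ‖ζ‖ ^ 2 ∂ν ≤ ε ^ 2 := by
  have h : ∫ ζ, ‖ζ‖ ^ 2 ∂ν ≤ ∫ _ζ : E, ε ^ 2 ∂ν := by
    refine integral_mono_ae (integrable_norm_pow_of_ae_norm_le hν 2) (integrable_const _) ?_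
    filter_upwards [hν] with ζ hζ
    show ‖ζ‖ ^ 2 ≤ ε ^ 2
    gcongr
  simpa using h

lemma integrable_halfHessian {ν : Measure E} [IsProbabilityMeasure ν] {ε α : ℝ} (hα : 0 < α)
    (hν : ∀ᵐ ζ ∂ν, ‖ζ‖ ≤ ε) {η : E} (hη : η ≠ 0) : Integrable (halfHessian α η) ν := by
  refine ((integrable_norm_pow_of_ae_norm_le hν 2).const_mul (α * (α + 3) * ‖η‖ ^ (-α - 2))).mono'
    (measurable_halfHessian_right α η).aestronglyMeasurable
    (Filter.Eventually.of_forall fun ζ => abs_halfHessian_le hα hη ζ)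

lemma abs_integral_halfHessian_le {ν : Measure E} [IsProbabilityMeasure ν] {ε α : ℝ} (hα : 0 < α)
    (hν : ∀ᵐ ζ ∂ν, ‖ζ‖ ≤ ε) {η : E} (hη : η ≠ 0) :
    |∫ ζ, halfHessian α η ζ ∂ν| ≤ α * (α + 3) * ‖η‖ ^ (-α - 2) * ∫ ζ, ‖ζ‖ ^ 2 ∂ν := by
  rw [← integral_const_mul, ← Real.norm_eq_abs]
  exact norm_integral_le_of_norm_le ((integrable_norm_pow_of_ae_norm_le hν 2).const_mul _)
    (Filter.Eventually.of_forall fun ζ => abs_halfHessian_le hα hη ζ)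

/-- Averaging the Taylor expansion of `‖·‖⁻ᵅ` over a centered measure near the origin. -/
lemma exists_integral_norm_sub_rpow_bound {α : ℝ} (hα : 0 < α) :
    ∃ K : ℝ, 0 ≤ K ∧ ∀ (ν : Measure E) [IsProbabilityMeasure ν] (ε : ℝ), 0 < ε →
      (∀ᵐ ζ ∂ν, ‖ζ‖ ≤ ε) → ∫ ζ, ζ ∂ν = 0 → ∀ η : E, 2 * ε ≤ ‖η‖ →
      |∫ ζ, ‖ζ - η‖ ^ (-α) ∂ν - ‖η‖ ^ (-α) - ∫ ζ, halfHessian α η ζ ∂ν|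
        ≤ K * ε * ‖η‖ ^ (-α - 3) * ∫ ζ, ‖ζ‖ ^ 2 ∂ν := by
  obtain ⟨K, hK, hbound⟩ := exists_norm_sub_rpow_taylor_bound (E := E) hα
  refine ⟨K, hK, fun ν _ ε hε hν hmean η hη => ?_⟩
  have hη' : η ≠ 0 := norm_pos_iff.1 (by linarith)
  have hint := integrable_norm_sub_rpow_neg hα hε hν hη
  have hlin : Integrable (fun ζ : E => α * ‖η‖ ^ (-α - 2) * inner ℝ η ζ) ν :=
    ((integrable_id_of_ae_norm_le_s10 hν).const_inner η).const_mul _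
  have hlin0 : ∫ ζ : E, α * ‖η‖ ^ (-α - 2) * inner ℝ η ζ ∂ν = 0 := by
    rw [integral_const_mul, integral_inner (integrable_id_of_ae_norm_le_s10 hν), hmean,
      inner_zero_right, mul_zero]
  have hH := integrable_halfHessian (α := α) hα hν hη'
  have heq : ∫ ζ, ‖ζ - η‖ ^ (-α) ∂ν - ‖η‖ ^ (-α) - ∫ ζ, halfHessian α η ζ ∂ν
      = ∫ ζ, (‖ζ - η‖ ^ (-α) - ‖η‖ ^ (-α) - α * ‖η‖ ^ (-α - 2) * inner ℝ η ζ
        - halfHessian α η ζ) ∂ν := by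
    have h1 : Integrable (fun ζ : E => ‖ζ - η‖ ^ (-α) - ‖η‖ ^ (-α)) ν :=
      hint.sub (integrable_const _)
    have h2 : Integrable (fun ζ : E => ‖ζ - η‖ ^ (-α) - ‖η‖ ^ (-α)
        - α * ‖η‖ ^ (-α - 2) * inner ℝ η ζ) ν := h1.sub hlin
    rw [integral_sub h2 hH, integral_sub h1 hlin, integral_sub hint (integrable_const _), hlin0]
    simp
  rw [heq, ← Real.norm_eq_abs, ← integral_const_mul]
  refine norm_integral_le_of_norm_le ((integrable_norm_pow_of_ae_norm_le hν 2).const_mul _) ?_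
  filter_upwards [hν] with ζ hζ
  refine (hbound η ζ hη' (by linarith)).trans ?_
  calc K * ‖η‖ ^ (-α - 3) * ‖ζ‖ ^ 3 = K * ‖ζ‖ * ‖η‖ ^ (-α - 3) * ‖ζ‖ ^ 2 := by ring
    _ ≤ K * ε * ‖η‖ ^ (-α - 3) * ‖ζ‖ ^ 2 := by gcongr

/-- The second order approximation, away from the support of `ν`, of the integrand
`‖η‖⁻ᵅ exp (-∫ ‖ζ - η‖⁻ᵅ ν(dζ))`. -/
noncomputable def expandedIntegrand (α : ℝ) (ν : Measure E) (η : E) : ℝ :=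
  ‖η‖ ^ (-α) * Real.exp (-‖η‖ ^ (-α)) * (1 - ∫ ζ, halfHessian α η ζ ∂ν)

lemma exists_abs_sub_expandedIntegrand_le {α : ℝ} (hα : 0 < α) :
    ∃ K : ℝ, 0 ≤ K ∧ ∀ (ν : Measure E) [IsProbabilityMeasure ν] (ε : ℝ), 0 < ε → ε ≤ 1 →
      (∀ᵐ ζ ∂ν, ‖ζ‖ ≤ ε) → ∫ ζ, ζ ∂ν = 0 → ∀ η : E, 2 * ε ≤ ‖η‖ →
      |‖η‖ ^ (-α) * Real.exp (-∫ ζ, ‖ζ - η‖ ^ (-α) ∂ν) - expandedIntegrand α ν η|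
        ≤ K * ε * (∫ ζ, ‖ζ‖ ^ 2 ∂ν) *
          (‖η‖ ^ (-(2 * α + 3)) * Real.exp (-((3 / 2) ^ (-α) * ‖η‖ ^ (-α)))
            + ‖η‖ ^ (-(3 * α + 4)) * Real.exp (-((3 / 2) ^ (-α) * ‖η‖ ^ (-α)))) := by
  obtain ⟨K, hK, hbound⟩ := exists_integral_norm_sub_rpow_bound (E := E) hα
  refine ⟨(K + α * (α + 3)) ^ 2 + K, by positivity, fun ν _ ε hε hε1 hν hmean η hη => ?_⟩
  have hη0 : 0 < ‖η‖ := by linarith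
  have hη' : η ≠ 0 := norm_pos_iff.1 hη0
  have hT := hbound ν ε hε hν hmean η hη
  have hQ := abs_integral_halfHessian_le hα hν hη'
  have hV := integral_norm_sq_le_s10 hν
  have hV0 : 0 ≤ ∫ ζ, ‖ζ‖ ^ 2 ∂ν := integral_nonneg fun ζ => by positivity
  have hc : (3 / 2 : ℝ) ^ (-α) * ‖η‖ ^ (-α) ≤ ∫ ζ, ‖ζ - η‖ ^ (-α) ∂ν := by
    have h : ∫ _ζ : E, (3 / 2 : ℝ) ^ (-α) * ‖η‖ ^ (-α) ∂ν ≤ ∫ ζ, ‖ζ - η‖ ^ (-α) ∂ν := by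
      refine integral_mono_ae (integrable_const _) (integrable_norm_sub_rpow_neg hα hε hν hη) ?_
      filter_upwards [hν] with ζ hζ
      rw [← Real.mul_rpow (by norm_num) hη0.le]
      have hb := norm_bounds_of_two_mul_le hη hζ
      exact Real.rpow_le_rpow_of_nonpos (hε.trans_le hb.1) hb.2 (by linarith)
    simpa using h
  have hc1 : (3 / 2 : ℝ) ^ (-α) ≤ 1 :=
    Real.rpow_le_one_of_one_le_of_nonpos (by norm_num) (by linarith)
  have hc' : (3 / 2 : ℝ) ^ (-α) * ‖η‖ ^ (-α) ≤ ‖η‖ ^ (-α) :=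
    mul_le_of_le_one_left (by positivity) hc1
  have hexp := abs_exp_neg_sub_add_le hc hc'
  rw [expandedIntegrand]
  set V := ∫ ζ, ‖ζ‖ ^ 2 ∂ν
  set f := ∫ ζ, ‖ζ - η‖ ^ (-α) ∂ν
  set Q := ∫ ζ, halfHessian α η ζ ∂ν
  set m := (3 / 2 : ℝ) ^ (-α) * ‖η‖ ^ (-α)
  have hpow : ‖η‖ ^ (-α - 3) = ‖η‖ ^ (-α - 2) * ‖η‖⁻¹ := by
    rw [← Real.rpow_neg_one, ← Real.rpow_add hη0]; ring_nf
  have hεη : ε * ‖η‖⁻¹ ≤ 1 := by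
    rw [← div_eq_mul_inv, div_le_one hη0]; linarith
  have hD : |f - ‖η‖ ^ (-α)| ≤ (K + α * (α + 3)) * ‖η‖ ^ (-α - 2) * V := by
    have h1 : K * ε * ‖η‖ ^ (-α - 3) * V ≤ K * ‖η‖ ^ (-α - 2) * V := by
      rw [hpow]
      calc K * ε * (‖η‖ ^ (-α - 2) * ‖η‖⁻¹) * V
          = K * ‖η‖ ^ (-α - 2) * V * (ε * ‖η‖⁻¹) := by ring
        _ ≤ K * ‖η‖ ^ (-α - 2) * V * 1 := by gcongr
        _ = _ := by ring
    calc |f - ‖η‖ ^ (-α)| = |(f - ‖η‖ ^ (-α) - Q) + Q| := by ring_nf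
      _ ≤ |f - ‖η‖ ^ (-α) - Q| + |Q| := abs_add_le _ _
      _ ≤ _ := by linarith
  have hD2 : (f - ‖η‖ ^ (-α)) ^ 2 ≤ (K + α * (α + 3)) ^ 2 * (‖η‖ ^ (-α - 2)) ^ 2 * (ε * V) := by
    rw [← sq_abs]
    calc |f - ‖η‖ ^ (-α)| ^ 2 ≤ ((K + α * (α + 3)) * ‖η‖ ^ (-α - 2) * V) ^ 2 := by gcongr
      _ = (K + α * (α + 3)) ^ 2 * (‖η‖ ^ (-α - 2)) ^ 2 * (V * V) := by ring
      _ ≤ _ := by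
        gcongr
        nlinarith
  have hm : Real.exp (-‖η‖ ^ (-α)) ≤ Real.exp (-m) := Real.exp_le_exp.2 (by linarith)
  have p1 : ‖η‖ ^ (-α) * (‖η‖ ^ (-α - 2)) ^ 2 = ‖η‖ ^ (-(3 * α + 4)) := by
    rw [← Real.rpow_natCast, ← Real.rpow_mul hη0.le, ← Real.rpow_add hη0]
    congr 1; push_cast; ring
  have p2 : ‖η‖ ^ (-α) * ‖η‖ ^ (-α - 3) = ‖η‖ ^ (-(2 * α + 3)) := by
    rw [← Real.rpow_add hη0]; congr 1; ring
  have hdecomp : ‖η‖ ^ (-α) * Real.exp (-f) - ‖η‖ ^ (-α) * Real.exp (-‖η‖ ^ (-α)) * (1 - Q)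
      = ‖η‖ ^ (-α) * (Real.exp (-f) - Real.exp (-‖η‖ ^ (-α))
          + Real.exp (-‖η‖ ^ (-α)) * (f - ‖η‖ ^ (-α)))
        - ‖η‖ ^ (-α) * (Real.exp (-‖η‖ ^ (-α)) * (f - ‖η‖ ^ (-α) - Q)) := by ring
  have b1 : |‖η‖ ^ (-α) * (Real.exp (-f) - Real.exp (-‖η‖ ^ (-α))
          + Real.exp (-‖η‖ ^ (-α)) * (f - ‖η‖ ^ (-α)))|
      ≤ (K + α * (α + 3)) ^ 2 * (ε * V) * (‖η‖ ^ (-(3 * α + 4)) * Real.exp (-m)) := by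
    rw [abs_mul, abs_of_nonneg (by positivity : 0 ≤ ‖η‖ ^ (-α)), ← p1]
    calc _ ≤ ‖η‖ ^ (-α) * ((K + α * (α + 3)) ^ 2 * (‖η‖ ^ (-α - 2)) ^ 2 * (ε * V)
            * Real.exp (-m)) := by
          gcongr
          exact hexp.trans (by gcongr)
      _ = _ := by ring
  have b2 : |‖η‖ ^ (-α) * (Real.exp (-‖η‖ ^ (-α)) * (f - ‖η‖ ^ (-α) - Q))|
      ≤ K * (ε * V) * (‖η‖ ^ (-(2 * α + 3)) * Real.exp (-m)) := by
    rw [abs_mul, abs_mul, abs_of_nonneg (by positivity : 0 ≤ ‖η‖ ^ (-α)),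
      abs_of_pos (Real.exp_pos _), ← p2]
    calc _ ≤ ‖η‖ ^ (-α) * (Real.exp (-m) * (K * ε * ‖η‖ ^ (-α - 3) * V)) := by gcongr
      _ = _ := by ring
  rw [hdecomp]
  refine (abs_sub _ _).trans ((add_le_add b1 b2).trans ?_)
  have q1 : 0 ≤ K * (ε * V) * (‖η‖ ^ (-(3 * α + 4)) * Real.exp (-m)) := by positivity
  have q2 : 0 ≤ (K + α * (α + 3)) ^ 2 * (ε * V) * (‖η‖ ^ (-(2 * α + 3)) * Real.exp (-m)) := by
    positivity
  linarith

end Centered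

lemma rpow_neg_mul_rpow_neg_sub_two {α : ℝ} (hα : 0 < α) {r : ℝ} (hr : 0 ≤ r) :
    r ^ (-α) * r ^ (-α - 2) = r ^ (-(2 * α + 2)) := by
  rw [← Real.rpow_add' hr (by linarith)]
  congr 1
  ring

/-- Pointwise bound of the second order term by an integrable radial function. -/
lemma abs_radial_mul_halfHessian_le {E : Type*} [NormedAddCommGroup E]
    [InnerProductSpace ℝ E] {α : ℝ} (hα : 0 < α) (η ζ : E) :
    |‖η‖ ^ (-α) * Real.exp (-‖η‖ ^ (-α)) * halfHessian α η ζ|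
      ≤ α * (α + 3) * (‖η‖ ^ (-(2 * α + 2)) * Real.exp (-‖η‖ ^ (-α))) * ‖ζ‖ ^ 2 := by
  rcases eq_or_ne η 0 with rfl | hη
  · simp only [norm_zero, Real.zero_rpow (neg_ne_zero.2 hα.ne'), zero_mul, abs_zero]
    positivity
  · rw [abs_mul, abs_of_nonneg (by positivity), ← rpow_neg_mul_rpow_neg_sub_two hα (norm_nonneg η)]
    calc _ ≤ ‖η‖ ^ (-α) * Real.exp (-‖η‖ ^ (-α))
          * (α * (α + 3) * ‖η‖ ^ (-α - 2) * ‖ζ‖ ^ 2) := by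
          gcongr
          exact abs_halfHessian_le hα hη ζ
      _ = _ := by ring

section Expansion

variable {E : Type*} [NormedAddCommGroup E] [InnerProductSpace ℝ E] [FiniteDimensional ℝ E]
  [MeasurableSpace E] [BorelSpace E] [Nontrivial E]

lemma integral_radial_mul_halfHessian {α : ℝ} (hα : (Module.finrank ℝ E : ℝ) < α) (ζ : E) :
    ∫ η : E, ‖η‖ ^ (-α) * Real.exp (-‖η‖ ^ (-α)) * halfHessian α η ζ
      = α * (α + 2 - Module.finrank ℝ E) / (2 * Module.finrank ℝ E)
        * (∫ η : E, ‖η‖ ^ (-(2 * α + 2)) * Real.exp (-‖η‖ ^ (-α))) * ‖ζ‖ ^ 2 := by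
  have hn : (0 : ℝ) < Module.finrank ℝ E := by
    exact_mod_cast Module.finrank_pos (R := ℝ) (M := E)
  have hα0 : 0 < α := hn.trans hα
  have hI : Integrable (fun η : E => ‖η‖ ^ (-(2 * α + 2)) * Real.exp (-‖η‖ ^ (-α))) := by
    simpa using integrable_norm_rpow_neg_mul_exp (E := E) hα0 one_pos
      (p := 2 * α + 2) (by linarith)
  set φ : ℝ → ℝ := fun r => r ^ (-α) * Real.exp (-r ^ (-α)) * r ^ (-α - 4) with hφ
  have hφm : Measurable φ := by rw [hφ]; fun_prop
  have hφ2 : ∀ η : E, φ ‖η‖ * ‖η‖ ^ 2 = ‖η‖ ^ (-(2 * α + 2)) * Real.exp (-‖η‖ ^ (-α)) := by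
    intro η
    have h : ‖η‖ ^ (-α - 4) * ‖η‖ ^ 2 = ‖η‖ ^ (-α - 2) := by
      rw [← Real.rpow_natCast, ← Real.rpow_add' (norm_nonneg η) (by push_cast; linarith)]
      congr 1
      push_cast
      ring
    rw [← rpow_neg_mul_rpow_neg_sub_two hα0 (norm_nonneg η), ← h]
    ring
  have hφI : Integrable (fun η : E => φ ‖η‖ * ‖η‖ ^ 2) := by simpa only [hφ2] using hI
  have hiso := integral_radial_mul_inner_sq_s10 φ hφI hφm ζ
  simp only [hφ2] at hiso
  have hinner := integrable_radial_mul_inner_sq φ hφI hφm ζ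
  have hsplit : ∀ η : E, ‖η‖ ^ (-α) * Real.exp (-‖η‖ ^ (-α)) * halfHessian α η ζ
      = α * (α + 2) / 2 * (φ ‖η‖ * inner ℝ η ζ ^ 2)
        - α / 2 * ‖ζ‖ ^ 2 * (‖η‖ ^ (-(2 * α + 2)) * Real.exp (-‖η‖ ^ (-α))) := by
    intro η
    rw [← rpow_neg_mul_rpow_neg_sub_two hα0 (norm_nonneg η), halfHessian, hφ]
    ring
  simp only [hsplit]
  rw [integral_sub (hinner.const_mul _) (hI.const_mul _), integral_const_mul, integral_const_mul,
    hiso]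
  field_simp

lemma integrable_expandedIntegrand_and_integral_eq {α : ℝ} (hα : (Module.finrank ℝ E : ℝ) < α)
    (ν : Measure E) [IsProbabilityMeasure ν] {ε : ℝ} (hν : ∀ᵐ ζ ∂ν, ‖ζ‖ ≤ ε) :
    Integrable (expandedIntegrand α ν) ∧
    ∫ η : E, expandedIntegrand α ν η = (∫ η : E, ‖η‖ ^ (-α) * Real.exp (-‖η‖ ^ (-α)))
      - α * (α + 2 - Module.finrank ℝ E) / (2 * Module.finrank ℝ E)
        * (∫ η : E, ‖η‖ ^ (-(2 * α + 2)) * Real.exp (-‖η‖ ^ (-α))) * ∫ ζ, ‖ζ‖ ^ 2 ∂ν := by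
  have hn : (0 : ℝ) < Module.finrank ℝ E := by
    exact_mod_cast Module.finrank_pos (R := ℝ) (M := E)
  have hα0 : 0 < α := hn.trans hα
  have hI1 : Integrable (fun η : E => ‖η‖ ^ (-α) * Real.exp (-‖η‖ ^ (-α))) := by
    simpa using integrable_norm_rpow_neg_mul_exp (E := E) hα0 one_pos hα
  have hI2 : Integrable (fun η : E => ‖η‖ ^ (-(2 * α + 2)) * Real.exp (-‖η‖ ^ (-α))) := by
    simpa using integrable_norm_rpow_neg_mul_exp (E := E) hα0 one_pos
      (p := 2 * α + 2) (by linarith)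
  have hprod : Integrable (Function.uncurry fun η ζ : E =>
      ‖η‖ ^ (-α) * Real.exp (-‖η‖ ^ (-α)) * halfHessian α η ζ) (volume.prod ν) := by
    have hm : Measurable (Function.uncurry fun η ζ : E =>
        ‖η‖ ^ (-α) * Real.exp (-‖η‖ ^ (-α)) * halfHessian α η ζ) := by
      unfold halfHessian Function.uncurry
      fun_prop
    refine ((hI2.const_mul (α * (α + 3))).mul_prod
      (integrable_norm_pow_of_ae_norm_le hν 2)).mono' hm.aestronglyMeasurable
      (Filter.Eventually.of_forall fun z => abs_radial_mul_halfHessian_le hα0 z.1 z.2)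
  have heq : ∀ η : E, expandedIntegrand α ν η = ‖η‖ ^ (-α) * Real.exp (-‖η‖ ^ (-α))
      - ∫ ζ, ‖η‖ ^ (-α) * Real.exp (-‖η‖ ^ (-α)) * halfHessian α η ζ ∂ν := by
    intro η
    rw [integral_const_mul, expandedIntegrand]
    ring
  have hleft : Integrable fun η : E =>
      ∫ ζ, ‖η‖ ^ (-α) * Real.exp (-‖η‖ ^ (-α)) * halfHessian α η ζ ∂ν := hprod.integral_prod_left
  constructor
  · rw [funext heq]
    exact hI1.sub hleft
  · rw [integral_congr_ae (Filter.Eventually.of_forall heq), integral_sub hI1 hleft,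
      integral_integral_swap hprod]
    simp only [integral_radial_mul_halfHessian hα]
    rw [integral_const_mul]

end Expansion

/-- The power `‖x‖⁻ᵅ` truncated at height `t`. -/
noncomputable def truncPow {E : Type*} [NormedAddCommGroup E] (α t : ℝ) (x : E) : ℝ :=
  min (‖x‖ ^ (-α)) t

lemma truncPow_mul_exp_le_of_norm_lt {E : Type*} [NormedAddCommGroup E]
    [MeasurableSpace E] [BorelSpace E] {α t ε : ℝ} (hα : 0 < α) (hε : 0 < ε) (hεt : ε ^ (-α) ≤ t)
    (ν : Measure E) [IsProbabilityMeasure ν] (hν : ∀ᵐ ζ ∂ν, ‖ζ‖ ≤ ε) {η : E}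
    (hη : ‖η‖ < 2 * ε) (hην : ν {η} = 0) :
    truncPow α t η * Real.exp (-∫ ζ, truncPow α t (ζ - η) ∂ν)
      ≤ t * Real.exp (-(3 * ε) ^ (-α)) := by
  have ht : 0 ≤ t := le_trans (by positivity) hεt
  have hmeas : Measurable fun ζ : E => truncPow α t (ζ - η) := by
    unfold truncPow
    fun_prop
  have hint : Integrable (fun ζ : E => truncPow α t (ζ - η)) ν := by
    refine Integrable.of_bound hmeas.aestronglyMeasurable t
      (Filter.Eventually.of_forall fun ζ => ?_)
    rw [Real.norm_of_nonneg (show 0 ≤ truncPow α t (ζ - η) from le_min (by positivity) ht)]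
    exact min_le_right _ _
  have hlow : (3 * ε) ^ (-α) ≤ ∫ ζ, truncPow α t (ζ - η) ∂ν := by
    have h : ∫ _ζ : E, (3 * ε) ^ (-α) ∂ν ≤ ∫ ζ, truncPow α t (ζ - η) ∂ν := by
      refine integral_mono_ae (integrable_const _) hint ?_
      have hne : ∀ᵐ ζ ∂ν, ζ ≠ η := by
        rw [ae_iff]
        simpa using hην
      filter_upwards [hν, hne] with ζ hζ hne
      refine le_min (Real.rpow_le_rpow_of_nonpos (norm_pos_iff.2 (sub_ne_zero.2 hne)) ?_
        (by linarith)) (le_trans ?_ hεt)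
      · linarith [norm_sub_le ζ η]
      · exact Real.rpow_le_rpow_of_nonpos hε (by linarith) (by linarith)
    simpa using h
  have h1 : truncPow α t η ≤ t := min_le_right _ _
  gcongr

section Main

variable {E : Type*} [NormedAddCommGroup E] [InnerProductSpace ℝ E] [FiniteDimensional ℝ E]
  [MeasurableSpace E] [BorelSpace E]

lemma abs_expandedIntegrand_le_of_norm_lt {α ε : ℝ} (hα : 0 < α)
    (ν : Measure E) [IsProbabilityMeasure ν] (hν : ∀ᵐ ζ ∂ν, ‖ζ‖ ≤ ε) {η : E}
    (hη : ‖η‖ < 2 * ε) (hη' : η ≠ 0) :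
    |expandedIntegrand α ν η|
      ≤ Real.exp (-((2 * ε) ^ (-α) / 2)) * (‖η‖ ^ (-α) * Real.exp (-(1 / 2 * ‖η‖ ^ (-α))))
        + 2 * α * (α + 3) * ε * (∫ ζ, ‖ζ‖ ^ 2 ∂ν)
          * (‖η‖ ^ (-(2 * α + 3)) * Real.exp (-‖η‖ ^ (-α))) := by
  have hη0 : 0 < ‖η‖ := norm_pos_iff.2 hη'
  have hQ := abs_integral_halfHessian_le hα hν hη'
  have hV0 : 0 ≤ ∫ ζ, ‖ζ‖ ^ 2 ∂ν := integral_nonneg fun ζ => by positivity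
  have hh : (2 * ε) ^ (-α) ≤ ‖η‖ ^ (-α) :=
    Real.rpow_le_rpow_of_nonpos hη0 hη.le (by linarith)
  have hexp : Real.exp (-‖η‖ ^ (-α))
      ≤ Real.exp (-((2 * ε) ^ (-α) / 2)) * Real.exp (-(1 / 2 * ‖η‖ ^ (-α))) := by
    rw [← Real.exp_add]
    exact Real.exp_le_exp.2 (by linarith)
  have hpow : ‖η‖ ^ (-α) * ‖η‖ ^ (-α - 2) ≤ 2 * ε * ‖η‖ ^ (-(2 * α + 3)) := by
    have h : ‖η‖ ^ (-α) * ‖η‖ ^ (-α - 2) = ‖η‖ * ‖η‖ ^ (-(2 * α + 3)) := by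
      rw [← Real.rpow_add hη0]
      nth_rewrite 2 [← Real.rpow_one ‖η‖]
      rw [← Real.rpow_add hη0]
      congr 1
      ring
    rw [h]
    gcongr
  rw [expandedIntegrand, abs_mul, abs_of_nonneg (by positivity)]
  set V := ∫ ζ, ‖ζ‖ ^ 2 ∂ν
  set Q := ∫ ζ, halfHessian α η ζ ∂ν
  calc ‖η‖ ^ (-α) * Real.exp (-‖η‖ ^ (-α)) * |1 - Q|
      ≤ ‖η‖ ^ (-α) * Real.exp (-‖η‖ ^ (-α)) * (1 + α * (α + 3) * ‖η‖ ^ (-α - 2) * V) := by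
        gcongr
        refine (abs_sub _ _).trans ?_
        rw [abs_one]
        gcongr
    _ = ‖η‖ ^ (-α) * Real.exp (-‖η‖ ^ (-α))
        + α * (α + 3) * V * Real.exp (-‖η‖ ^ (-α)) * (‖η‖ ^ (-α) * ‖η‖ ^ (-α - 2)) := by ring
    _ ≤ ‖η‖ ^ (-α) * (Real.exp (-((2 * ε) ^ (-α) / 2)) * Real.exp (-(1 / 2 * ‖η‖ ^ (-α))))
        + α * (α + 3) * V * Real.exp (-‖η‖ ^ (-α)) * (2 * ε * ‖η‖ ^ (-(2 * α + 3))) := by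
        gcongr
    _ = _ := by ring

variable [Nontrivial E]

lemma ae_measure_singleton_eq_zero_s10 (ν : Measure E) [SFinite ν] :
    ∀ᵐ η : E, ν {η} = 0 := by
  have h : {η : E | 0 < ν {η}}.Countable := Measure.countable_meas_pos_of_disjoint_iUnion
    (fun η => measurableSet_singleton η)
    (fun x y hxy => Set.disjoint_singleton.2 hxy)
  have := h.measure_zero (volume : Measure E)
  rw [ae_iff]
  simpa [pos_iff_ne_zero] using this

/-- Quantitative expansion of the rescaled integral for a centered measure carried by a small
ball. -/
lemma exists_abs_integral_truncPow_sub_le {α : ℝ} (hα : (Module.finrank ℝ E : ℝ) < α) :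
    ∃ K : ℝ, 0 ≤ K ∧ ∀ (ν : Measure E) [IsProbabilityMeasure ν] (ε t : ℝ), 0 < ε → ε ≤ 1 →
      ε ^ (-α) ≤ t → (∀ᵐ ζ ∂ν, ‖ζ‖ ≤ ε) → ∫ ζ, ζ ∂ν = 0 →
      |(∫ η : E, truncPow α t η * Real.exp (-∫ ζ, truncPow α t (ζ - η) ∂ν))
        - ((∫ η : E, ‖η‖ ^ (-α) * Real.exp (-‖η‖ ^ (-α)))
          - α * (α + 2 - Module.finrank ℝ E) / (2 * Module.finrank ℝ E)
            * (∫ η : E, ‖η‖ ^ (-(2 * α + 2)) * Real.exp (-‖η‖ ^ (-α))) * ∫ ζ, ‖ζ‖ ^ 2 ∂ν)|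
        ≤ K * ε * (∫ ζ, ‖ζ‖ ^ 2 ∂ν) + K * (1 + t) * Real.exp (-((3 * ε) ^ (-α) / 2)) := by
  have hn : (0 : ℝ) < Module.finrank ℝ E := by
    exact_mod_cast Module.finrank_pos (R := ℝ) (M := E)
  have hα0 : 0 < α := hn.trans hα
  obtain ⟨K, hK, hbound⟩ := exists_abs_sub_expandedIntegrand_le (E := E) hα0
  have hc : (0 : ℝ) < (3 / 2) ^ (-α) := by positivity
  set outer : E → ℝ := fun η =>
    ‖η‖ ^ (-(2 * α + 3)) * Real.exp (-((3 / 2) ^ (-α) * ‖η‖ ^ (-α)))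
      + ‖η‖ ^ (-(3 * α + 4)) * Real.exp (-((3 / 2) ^ (-α) * ‖η‖ ^ (-α))) with houter
  set innerOne : E → ℝ := fun η => ‖η‖ ^ (-α) * Real.exp (-(1 / 2 * ‖η‖ ^ (-α))) with hinnerOne
  set innerTwo : E → ℝ := fun η => ‖η‖ ^ (-(2 * α + 3)) * Real.exp (-‖η‖ ^ (-α)) with hinnerTwo
  have houterI : Integrable outer :=
    (integrable_norm_rpow_neg_mul_exp hα0 hc (by linarith)).add
      (integrable_norm_rpow_neg_mul_exp hα0 hc (by linarith))
  have hinnerOneI : Integrable innerOne :=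
    integrable_norm_rpow_neg_mul_exp hα0 (by norm_num) hα
  have hinnerTwoI : Integrable innerTwo := by
    simpa only [hinnerTwo, one_mul] using integrable_norm_rpow_neg_mul_exp (E := E) hα0 one_pos
      (p := 2 * α + 3) (by linarith)
  have houter0 : ∀ η, 0 ≤ outer η := fun η => by positivity
  have hinnerOne0 : ∀ η, 0 ≤ innerOne η := fun η => by positivity
  have hinnerTwo0 : ∀ η, 0 ≤ innerTwo η := fun η => by positivity
  set A := ∫ η, outer η
  set B := ∫ η, innerOne η
  set C := ∫ η, innerTwo η
  set D := volume.real (Metric.ball (0 : E) 2)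
  have hA : 0 ≤ A := integral_nonneg houter0
  have hB : 0 ≤ B := integral_nonneg hinnerOne0
  have hC : 0 ≤ C := integral_nonneg hinnerTwo0
  have hD : 0 ≤ D := measureReal_nonneg
  refine ⟨K * A + 2 * α * (α + 3) * C + B + D, by positivity,
    fun ν _ ε t hε hε1 hεt hν hmean => ?_⟩
  have ht : 0 ≤ t := le_trans (by positivity) hεt
  obtain ⟨hPI, hP⟩ := integrable_expandedIntegrand_and_integral_eq hα ν hν
  have hV0 : 0 ≤ ∫ ζ, ‖ζ‖ ^ 2 ∂ν := integral_nonneg fun ζ => by positivity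
  rw [← hP]
  set V := ∫ ζ, ‖ζ‖ ^ 2 ∂ν
  set Ψ : E → ℝ := fun η => truncPow α t η * Real.exp (-∫ ζ, truncPow α t (ζ - η) ∂ν) with hΨ
  have hΨm : Measurable Ψ := by
    have h1 : Measurable (Function.uncurry fun η ζ : E => truncPow α t (ζ - η)) := by
      unfold truncPow Function.uncurry
      fun_prop
    have h2 : Measurable fun η : E => ∫ ζ, truncPow α t (ζ - η) ∂ν :=
      (StronglyMeasurable.integral_prod_right h1.stronglyMeasurable).measurable
    have h3 : Measurable fun η : E => truncPow α t η := by
      unfold truncPow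
      fun_prop
    exact h3.mul (Real.measurable_exp.comp h2.neg)
  set e := Real.exp (-((3 * ε) ^ (-α) / 2)) with he
  set g : E → ℝ := fun η => K * ε * V * outer η
    + (Metric.ball (0 : E) 2).indicator (fun _ => t * e) η
    + e * innerOne η + 2 * α * (α + 3) * ε * V * innerTwo η with hg
  have hballI : Integrable ((Metric.ball (0 : E) 2).indicator fun _ => t * e) :=
    (integrableOn_const (measure_ball_lt_top.ne)).integrable_indicator measurableSet_ball
  have h12 : Integrable (fun η : E => K * ε * V * outer η
      + (Metric.ball (0 : E) 2).indicator (fun _ => t * e) η) :=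
    (houterI.const_mul (K * ε * V)).add hballI
  have h123 : Integrable (fun η : E => K * ε * V * outer η
      + (Metric.ball (0 : E) 2).indicator (fun _ => t * e) η + e * innerOne η) :=
    h12.add (hinnerOneI.const_mul e)
  have hgI : Integrable g := h123.add (hinnerTwoI.const_mul (2 * α * (α + 3) * ε * V))
  have hgint : ∫ η, g η
      = K * ε * V * A + D * (t * e) + e * B + 2 * α * (α + 3) * ε * V * C := by
    rw [hg, integral_add h123 (hinnerTwoI.const_mul (2 * α * (α + 3) * ε * V)),
      integral_add h12 (hinnerOneI.const_mul e),
      integral_add (houterI.const_mul (K * ε * V)) hballI,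
      integral_const_mul, integral_const_mul, integral_const_mul,
      integral_indicator_const _ measurableSet_ball, smul_eq_mul]
  have hmono : (3 * ε) ^ (-α) ≤ (2 * ε) ^ (-α) :=
    Real.rpow_le_rpow_of_nonpos (by linarith) (by linarith) (by linarith)
  have hpos3 : 0 ≤ (3 * ε) ^ (-α) := by positivity
  have hle : ∀ᵐ η : E, ‖Ψ η - expandedIntegrand α ν η‖ ≤ g η := by
    have hne : ∀ᵐ η : E, η ≠ 0 := by
      rw [ae_iff]
      simp
    filter_upwards [ae_measure_singleton_eq_zero_s10 ν, hne] with η hην hη0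
    have n1 : 0 ≤ K * ε * V * outer η := mul_nonneg (by positivity) (houter0 η)
    have n2 : 0 ≤ (Metric.ball (0 : E) 2).indicator (fun _ => t * e) η :=
      Set.indicator_nonneg (fun _ _ => by positivity) η
    have n3 : 0 ≤ e * innerOne η := mul_nonneg (by positivity) (hinnerOne0 η)
    have n4 : 0 ≤ 2 * α * (α + 3) * ε * V * innerTwo η := mul_nonneg (by positivity) (hinnerTwo0 η)
    rw [Real.norm_eq_abs]
    simp only [hg]
    rcases le_or_gt (2 * ε) ‖η‖ with hη | hη
    · have e1 : truncPow α t η = ‖η‖ ^ (-α) := min_eq_left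
        ((Real.rpow_le_rpow_of_nonpos hε (by linarith) (by linarith)).trans hεt)
      have e2 : ∫ ζ, truncPow α t (ζ - η) ∂ν = ∫ ζ, ‖ζ - η‖ ^ (-α) ∂ν := by
        refine integral_congr_ae ?_
        filter_upwards [hν] with ζ hζ
        exact min_eq_left ((Real.rpow_le_rpow_of_nonpos hε
          (norm_bounds_of_two_mul_le hη hζ).1 (by linarith)).trans hεt)
      have h := hbound ν ε hε hε1 hν hmean η hη
      simp only [hΨ, e1, e2]
      linarith
    · have h1 := truncPow_mul_exp_le_of_norm_lt hα0 hε hεt ν hν hη hην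
      have h2 := abs_expandedIntegrand_le_of_norm_lt hα0 ν hν hη hη0
      have h3 : 0 ≤ Ψ η := mul_nonneg (le_min (by positivity) ht) (Real.exp_pos _).le
      have h4 : η ∈ Metric.ball (0 : E) 2 := by
        rw [mem_ball_zero_iff]
        linarith
      have h5 : Real.exp (-(3 * ε) ^ (-α)) ≤ e := Real.exp_le_exp.2 (by linarith)
      have h6 : Real.exp (-((2 * ε) ^ (-α) / 2)) ≤ e := Real.exp_le_exp.2 (by linarith)
      have h7 := mul_le_mul_of_nonneg_left h5 ht
      have h8 := mul_le_mul_of_nonneg_right h6 (hinnerOne0 η)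
      rw [Set.indicator_of_mem h4]
      have h9 := abs_sub (Ψ η) (expandedIntegrand α ν η)
      rw [abs_of_nonneg h3] at h9
      linarith
  have hdiff : Integrable fun η => Ψ η - expandedIntegrand α ν η :=
    hgI.mono' (hΨm.aestronglyMeasurable.sub hPI.aestronglyMeasurable) hle
  have hΨI : Integrable Ψ :=
    (hdiff.add hPI).congr (Filter.Eventually.of_forall fun η => by simp)
  have hfinal : |(∫ η, Ψ η) - ∫ η, expandedIntegrand α ν η| ≤ ∫ η, g η := by
    rw [← integral_sub hΨI hPI, ← Real.norm_eq_abs]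
    exact norm_integral_le_of_norm_le hgI hle
  rw [hgint] at hfinal
  have he0 : 0 ≤ e := (Real.exp_pos _).le
  have r1 : 0 ≤ (B + D) * (ε * V) := by positivity
  have r2 : 0 ≤ (K * A + 2 * α * (α + 3) * C) * ((1 + t) * e) := by positivity
  have r3 : 0 ≤ D * e := by positivity
  have r4 : 0 ≤ B * (t * e) := by positivity
  refine hfinal.trans ?_
  linarith

end Main

lemma mul_vhat_smul_eq_truncPow {d : ℕ} {α t : ℝ} (hα : 0 < α) (ht : 0 < t)
    (x : EuclideanSpace ℝ (Fin d)) :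
    t * vhat d α (t ^ (1 / α) • x) = truncPow α t x := by
  have h : (t ^ (1 / α)) ^ (-α) = t⁻¹ := by
    rw [← Real.rpow_mul ht.le, ← Real.rpow_neg_one]
    congr 1
    field_simp
  rw [vhat, truncPow, norm_smul, Real.norm_of_nonneg (by positivity),
    Real.mul_rpow (by positivity) (norm_nonneg x), h, mul_min_of_nonneg _ _ ht.le, mul_one,
    mul_inv_cancel_left₀ ht.ne']

/-- The law of the recentered and rescaled variable `t^{-1/α} (z - m)`. -/
noncomputable def rescaledLaw {d : ℕ} (α t : ℝ) (m : EuclideanSpace ℝ (Fin d))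
    (μ : Measure (EuclideanSpace ℝ (Fin d))) : Measure (EuclideanSpace ℝ (Fin d)) :=
  μ.map fun z => (t ^ (1 / α))⁻¹ • (z - m)

lemma integral_rescaledLaw {d : ℕ} {F : Type*} [NormedAddCommGroup F] [NormedSpace ℝ F]
    [MeasurableSpace F] [BorelSpace F] [SecondCountableTopology F]
    (α t : ℝ) (m : EuclideanSpace ℝ (Fin d)) (μ : Measure (EuclideanSpace ℝ (Fin d)))
    {f : EuclideanSpace ℝ (Fin d) → F} (hf : Measurable f) :
    ∫ ζ, f ζ ∂rescaledLaw α t m μ = ∫ z, f ((t ^ (1 / α))⁻¹ • (z - m)) ∂μ :=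
  integral_map (by fun_prop) hf.aestronglyMeasurable

lemma integral_vhat_mul_exp_eq {d : ℕ} {α t : ℝ} (hα : 0 < α) (ht : 0 < t)
    (m : EuclideanSpace ℝ (Fin d)) (μ : Measure (EuclideanSpace ℝ (Fin d))) :
    ∫ y, vhat d α (m - y) * Real.exp (-t * ∫ z, vhat d α (z - y) ∂μ)
      = t ^ (-(α - d) / α) * ∫ η : EuclideanSpace ℝ (Fin d), truncPow α t η
        * Real.exp (-∫ ζ, truncPow α t (ζ - η) ∂rescaledLaw α t m μ) := by
  set l := t ^ (1 / α) with hl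
  have hl0 : 0 < l := by positivity
  set f : EuclideanSpace ℝ (Fin d) → ℝ := fun y =>
    vhat d α (m - y) * Real.exp (-t * ∫ z, vhat d α (z - y) ∂μ) with hf
  have hpt : ∀ η : EuclideanSpace ℝ (Fin d), f (m + l • η) = t⁻¹ * (truncPow α t η
        * Real.exp (-∫ ζ, truncPow α t (ζ - η) ∂rescaledLaw α t m μ)) := by
    intro η
    have h1 : vhat d α (m - (m + l • η)) = t⁻¹ * truncPow α t η := by
      rw [← mul_vhat_smul_eq_truncPow hα ht, inv_mul_cancel_left₀ ht.ne', ← hl, vhat, vhat]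
      simp
    have h2 : -t * ∫ z, vhat d α (z - (m + l • η)) ∂μ
        = -∫ ζ, truncPow α t (ζ - η) ∂rescaledLaw α t m μ := by
      rw [integral_rescaledLaw α t m μ (by unfold truncPow; fun_prop), neg_mul,
        ← integral_const_mul]
      congr 2
      ext z
      rw [← mul_vhat_smul_eq_truncPow hα ht, ← hl, smul_sub, smul_inv_smul₀ hl0.ne', sub_sub]
    simp only [hf]
    rw [h1, h2]
    ring
  have hscale : (∫ y, f y) = l ^ d * ∫ η, f (m + l • η) := by
    have h := Measure.integral_comp_smul (volume : Measure (EuclideanSpace ℝ (Fin d)))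
      (fun y => f (m + y)) l
    rw [integral_add_left_eq_self f m] at h
    rw [h, finrank_euclideanSpace_fin, abs_of_pos (by positivity), smul_eq_mul,
      mul_inv_cancel_left₀ (by positivity)]
  have hconst : l ^ d * t⁻¹ = t ^ (-(α - d) / α) := by
    rw [hl, ← Real.rpow_natCast, ← Real.rpow_mul ht.le, ← Real.rpow_neg_one,
      ← Real.rpow_add ht]
    congr 1
    field_simp
    ring
  simp only [hf] at hscale hpt ⊢
  rw [hscale, ← hconst, mul_assoc]
  simp only [hpt]
  rw [integral_const_mul]

lemma tendsto_mul_exp_neg_rpow {γ : ℝ} (hγ : 0 < γ) :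
    Filter.Tendsto (fun t : ℝ => t * Real.exp (-t ^ γ)) Filter.atTop (nhds 0) := by
  have h := (tendsto_rpow_mul_exp_neg_mul_atTop_nhds_zero (1 / γ) 1 one_pos).comp
    (tendsto_rpow_atTop hγ)
  refine h.congr' ?_
  filter_upwards [Filter.eventually_gt_atTop 0] with t ht
  simp only [Function.comp]
  rw [← Real.rpow_mul ht.le, mul_one_div_cancel hγ.ne', Real.rpow_one]
  simp

lemma eventually_mul_exp_neg_le_exp_neg {c γ : ℝ} (hc : 0 < c) (hγ : 0 < γ) {K : ℝ} (hK : 0 ≤ K) :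
    ∀ᶠ t : ℝ in Filter.atTop,
      K * (1 + t) * Real.exp (-(c * t ^ (2 * γ))) ≤ Real.exp (-t ^ γ) := by
  have hsmall := ((tendsto_mul_exp_neg_rpow hγ).const_mul (2 * K)).eventually_le_const
    (u := 1) (by simp)
  have hlarge := ((tendsto_rpow_atTop hγ).const_mul_atTop hc).eventually_ge_atTop 2
  filter_upwards [hsmall, hlarge, Filter.eventually_ge_atTop 1] with t h1 h2 h3
  have ht : 0 < t := by linarith
  have hx : 0 < t ^ γ := by positivity
  have hsq : t ^ (2 * γ) = t ^ γ * t ^ γ := by rw [← Real.rpow_add ht]; ring_nf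
  have h4 : Real.exp (-(c * t ^ (2 * γ))) ≤ Real.exp (-t ^ γ) * Real.exp (-t ^ γ) := by
    rw [← Real.exp_add, hsq]
    refine Real.exp_le_exp.2 ?_
    nlinarith
  calc K * (1 + t) * Real.exp (-(c * t ^ (2 * γ)))
      ≤ K * (t + t) * (Real.exp (-t ^ γ) * Real.exp (-t ^ γ)) := by gcongr
    _ = (2 * K * (t * Real.exp (-t ^ γ))) * Real.exp (-t ^ γ) := by ring
    _ ≤ 1 * Real.exp (-t ^ γ) := by gcongr
    _ = _ := one_mul _

/-- deterministic form of the weighted mean of the potential at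
the barycenter: `E_t^μ[V_ω(m_μ)] = a₁(d/α) t^{−(α−d)/α}
− ((α−d+2)/α)(C(d,α)+o(1)) t^{−(α−d+2)/α} ∫|x−m_μ|²μ(dx)` up to `exp(−t^γ)`. -/
theorem stmt_10 (d : ℕ) (hd : 1 ≤ d) (α : ℝ) (hα₁ : (d : ℝ) < α)
    (hα₂ : α < d + 2) (M : ℝ) (hM : 0 < M) :
    ∃ γ : ℝ, 0 < γ ∧ ∀ δ : ℝ, 0 < δ → ∃ T : ℝ, 0 < T ∧ ∀ t : ℝ, T ≤ t →
      ∀ μ : Measure (EuclideanSpace ℝ (Fin d)), IsProbabilityMeasure μ →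
        μ (Metric.closedBall (0 : EuclideanSpace ℝ (Fin d))
            (t ^ ((α - d + 2) / (4 * α)) * Real.log t))ᶜ = 0 →
        (∫ x, ‖x - (∫ w, w ∂μ)‖ ^ 2 ∂μ) ≤ M * t ^ ((α - d + 2) / (2 * α)) →
        |(∫ y : EuclideanSpace ℝ (Fin d),
              vhat d α ((∫ w, w ∂μ) - y)
                * Real.exp (-t * ∫ z, vhat d α (z - y) ∂μ))
            - a1 d α * ((d : ℝ) / α) * t ^ (-(α - d) / α)
            + ((α - d + 2) / α) * Cda d α * t ^ (-(α - d + 2) / α)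
                * (∫ x, ‖x - (∫ w, w ∂μ)‖ ^ 2 ∂μ)|
          ≤ δ * t ^ (-(α - d + 2) / α) * (∫ x, ‖x - (∫ w, w ∂μ)‖ ^ 2 ∂μ)
            + Real.exp (-t ^ γ) := by
  have hd0 : (0 : ℝ) < d := by exact_mod_cast hd
  have hα : 0 < α := hd0.trans hα₁
  have : Nonempty (Fin d) := ⟨⟨0, hd⟩⟩
  have hfin : (Module.finrank ℝ (EuclideanSpace ℝ (Fin d)) : ℝ) = d := by
    rw [finrank_euclideanSpace_fin]
  obtain ⟨K, hK, hbound⟩ := exists_abs_integral_truncPow_sub_le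
    (E := EuclideanSpace ℝ (Fin d)) (α := α) (by rw [hfin]; exact hα₁)
  rw [integral_norm_rpow_neg_mul_exp hα (by rw [hfin]; exact hα₁),
    integral_norm_rpow_neg_mul_exp hα (by rw [hfin]; linarith), hfin] at hbound
  set κ : ℝ := (d + 2 - α) / (8 * α) with hκ
  have hκ0 : 0 < κ := div_pos (by linarith) (by positivity)
  have hκα : κ * α = (d + 2 - α) / 8 := by rw [hκ]; field_simp
  have hγ : 0 < κ * α / 2 := by positivity
  refine ⟨κ * α / 2, hγ, fun δ hδ => ?_⟩
  have hc : 0 < (3 : ℝ) ^ (-α) / 2 := by positivity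
  have ev1 := eventually_mul_exp_neg_le_exp_neg hc hγ hK
  have ev2 := ((tendsto_rpow_neg_atTop hκ0).const_mul K).eventually_le_const (u := δ)
    (by simpa using hδ)
  have ev3 := (isLittleO_log_rpow_atTop hκ0).bound (show (0 : ℝ) < 1 / 2 by norm_num)
  obtain ⟨T, hT⟩ := Filter.eventually_atTop.1
    ((ev1.and ev2).and (ev3.and (Filter.eventually_ge_atTop (1 : ℝ))))
  refine ⟨max T 1, by positivity, fun t ht μ hμ hsupp _ => ?_⟩
  obtain ⟨⟨h1, h2⟩, h3, ht1⟩ := hT t ((le_max_left _ _).trans ht)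
  have ht0 : 0 < t := by linarith
  set R := t ^ ((α - d + 2) / (4 * α)) * Real.log t with hR
  have hsupp' : ∀ᵐ z ∂μ, ‖z‖ ≤ R := by
    rw [ae_iff]
    convert hsupp using 2
    ext z
    simp
  have hμI : Integrable (fun z => z) μ := integrable_id_of_ae_norm_le_s10 hsupp'
  set m := ∫ w, w ∂μ with hm
  have hmR : ‖m‖ ≤ R := by
    have h := norm_integral_le_of_norm_le_const hsupp'
    simpa using h
  set l := t ^ (1 / α) with hl
  have hl0 : 0 < l := by positivity
  have hmeas : Measurable fun z : EuclideanSpace ℝ (Fin d) => l⁻¹ • (z - m) := by fun_prop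
  have : IsProbabilityMeasure (rescaledLaw α t m μ) :=
    Measure.isProbabilityMeasure_map hmeas.aemeasurable
  have hscale : 2 * R ≤ l * t ^ (-κ) := by
    have hlog : 2 * Real.log t ≤ t ^ κ := by
      rw [Real.norm_of_nonneg (Real.log_nonneg ht1), Real.norm_of_nonneg (by positivity)] at h3
      linarith
    have hexp : l * t ^ (-κ) = t ^ ((α - d + 2) / (4 * α)) * t ^ κ := by
      rw [hl, ← Real.rpow_add ht0, ← Real.rpow_add ht0, hκ]
      congr 1
      field_simp
      ring
    rw [hexp, hR]
    calc _ = t ^ ((α - d + 2) / (4 * α)) * (2 * Real.log t) := by ring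
      _ ≤ _ := by gcongr
  have hν : ∀ᵐ ζ ∂rescaledLaw α t m μ, ‖ζ‖ ≤ t ^ (-κ) := by
    rw [rescaledLaw, ae_map_iff hmeas.aemeasurable (measurableSet_le (by fun_prop) (by fun_prop))]
    filter_upwards [hsupp'] with z hz
    rw [norm_smul, norm_inv, Real.norm_of_nonneg hl0.le, inv_mul_le_iff₀ hl0]
    linarith [norm_sub_le z m]
  have hmean : ∫ ζ, ζ ∂rescaledLaw α t m μ = 0 := by
    rw [integral_rescaledLaw α t m μ measurable_id', integral_smul,
      integral_sub hμI (integrable_const _)]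
    simp [hm]
  have hvar : ∫ x, ‖x - m‖ ^ 2 ∂μ = l ^ 2 * ∫ ζ, ‖ζ‖ ^ 2 ∂rescaledLaw α t m μ := by
    rw [integral_rescaledLaw α t m μ (by fun_prop), ← integral_const_mul]
    congr 1
    ext x
    rw [norm_smul, norm_inv, Real.norm_of_nonneg hl0.le, mul_pow, inv_pow,
      mul_inv_cancel_left₀ (by positivity)]
  have hε1 : t ^ (-κ) ≤ 1 := Real.rpow_le_one_of_one_le_of_nonpos ht1 (by linarith)
  have hεα : (t ^ (-κ)) ^ (-α) = t ^ (κ * α) := by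
    rw [← Real.rpow_mul ht0.le]
    congr 1
    ring
  have hεt : (t ^ (-κ)) ^ (-α) ≤ t := by
    rw [hεα]
    calc t ^ (κ * α) ≤ t ^ (1 : ℝ) :=
          Real.rpow_le_rpow_of_exponent_le ht1 (by rw [hκα]; linarith)
      _ = t := Real.rpow_one t
  have hmain := hbound (rescaledLaw α t m μ) (t ^ (-κ)) t (by positivity) hε1 hεt hν hmean
  rw [Real.mul_rpow (by norm_num) (by positivity), hεα] at hmain
  rw [show 2 * (κ * α / 2) = κ * α by ring,
    show 3 ^ (-α) / 2 * t ^ (κ * α) = 3 ^ (-α) * t ^ (κ * α) / 2 by ring] at h1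
  have hV0 : 0 ≤ ∫ ζ, ‖ζ‖ ^ 2 ∂rescaledLaw α t m μ := integral_nonneg fun ζ => by positivity
  rw [integral_vhat_mul_exp_eq hα ht0, hvar]
  set V := ∫ ζ, ‖ζ‖ ^ 2 ∂rescaledLaw α t m μ
  set G := ∫ η : EuclideanSpace ℝ (Fin d), truncPow α t η
    * Real.exp (-∫ ζ, truncPow α t (ζ - η) ∂rescaledLaw α t m μ)
  have hs : t ^ (-(α - d + 2) / α) * l ^ 2 = t ^ (-(α - d) / α) := by
    rw [hl, ← Real.rpow_natCast, ← Real.rpow_mul ht0.le, ← Real.rpow_add ht0]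
    congr 1
    push_cast
    field_simp
    ring
  have hs1 : t ^ (-(α - d) / α) ≤ 1 :=
    Real.rpow_le_one_of_one_le_of_nonpos ht1
      (div_nonpos_of_nonpos_of_nonneg (by linarith) hα.le)
  have hω : volume.real (Metric.ball (0 : EuclideanSpace ℝ (Fin d)) 1) = omegaD d := rfl
  rw [hω, show 2 * α + 2 - (d : ℝ) = 2 * α - d + 2 by ring] at hmain
  have hlhs : t ^ (-(α - d) / α) * G - a1 d α * ((d : ℝ) / α) * t ^ (-(α - d) / α)
      + (α - d + 2) / α * Cda d α * t ^ (-(α - d + 2) / α) * (l ^ 2 * V)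
      = t ^ (-(α - d) / α) * (G - (d * omegaD d / α * Real.Gamma ((α - d) / α)
        - α * (α + 2 - d) / (2 * d)
          * (d * omegaD d / α * Real.Gamma ((2 * α - d + 2) / α)) * V)) := by
    rw [← hs, a1, Cda]
    field_simp
    ring
  have hrhs : δ * t ^ (-(α - d + 2) / α) * (l ^ 2 * V) = t ^ (-(α - d) / α) * (δ * V) := by
    rw [← hs]
    ring
  rw [hlhs, hrhs, abs_mul, abs_of_nonneg (by positivity)]
  calc _ ≤ t ^ (-(α - d) / α) * (δ * V + Real.exp (-t ^ (κ * α / 2))) := by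
        gcongr
        refine hmain.trans (add_le_add ?_ h1)
        gcongr
    _ ≤ t ^ (-(α - d) / α) * (δ * V) + 1 * Real.exp (-t ^ (κ * α / 2)) := by
        rw [mul_add]
        gcongr
    _ = _ := by rw [one_mul]
end
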